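/- arXiv:2504.20985 — 2 statements merged into one kernel-verified Lean document; each statement's English description precedes it below -/
import Mathlib

section
/- Let G be a non-virtually-cyclic group with finite generating set S. Suppose G acts by isometries on a geodesic δ-hyperbolic space X with basepoint x_0, and some element of G is a loxodromic isometry of X with the WPD property. Then for every M > 0, lim_{n→∞} #{g ∈ B_S(n) : g is a loxodromic isometry of X with the WPD property and τ_X(g) > M} / #B_S(n) = 1. -/
namespace AcylCount

/-! ### Geodesic segments and Gromov hyperbolicity -/

/-- A finite geodesic segment in a metric space, parametrized by arclength on `[0, len]`,
oriented from `initial := toFun 0` to `terminal := toFun len`. -/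
structure GeodesicSegment (X : Type*) [MetricSpace X] where
  len : ℝ
  len_nonneg : 0 ≤ len
  toFun : ℝ → X
  isom : ∀ s ∈ Set.Icc (0:ℝ) len, ∀ t ∈ Set.Icc (0:ℝ) len,
    dist (toFun s) (toFun t) = |s - t|

namespace GeodesicSegment

variable {X : Type*} [MetricSpace X]

/-- The initial point of a geodesic segment. -/
def initial (γ : GeodesicSegment X) : X := γ.toFun 0

/-- The terminal point of a geodesic segment. -/
def terminal (γ : GeodesicSegment X) : X := γ.toFun γ.len

/-- The image (underlying set) of a geodesic segment. -/
def seg (γ : GeodesicSegment X) : Set X := γ.toFun '' Set.Icc 0 γ.len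

/-- The translate of a geodesic segment by an isometry. -/
def translate (γ : GeodesicSegment X) (f : X → X) (hf : Isometry f) :
    GeodesicSegment X where
  len := γ.len
  len_nonneg := γ.len_nonneg
  toFun := f ∘ γ.toFun
  isom := fun s hs t ht => by
    simp only [Function.comp_apply, hf.dist_eq]
    exact γ.isom s hs t ht

/-- The degenerate geodesic segment consisting of a single point. -/
def point (p : X) : GeodesicSegment X where
  len := 0
  len_nonneg := le_refl 0
  toFun := fun _ => p
  isom := fun s hs t ht => by
    have hs0 : s = 0 := le_antisymm hs.2 hs.1
    have ht0 : t = 0 := le_antisymm ht.2 ht.1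
    simp [hs0, ht0]

/-- `η` is a subsegment of `γ`. -/
def IsSubsegment (η γ : GeodesicSegment X) : Prop :=
  ∃ a b : ℝ, 0 ≤ a ∧ a ≤ b ∧ b ≤ γ.len ∧ η.len = b - a ∧
    ∀ t ∈ Set.Icc (0:ℝ) η.len, η.toFun t = γ.toFun (a + t)

/-- `p` occurs (weakly) before `q` along the oriented geodesic segment `γ`. -/
def Before (γ : GeodesicSegment X) (p q : X) : Prop :=
  ∃ s t : ℝ, s ∈ Set.Icc (0:ℝ) γ.len ∧ t ∈ Set.Icc (0:ℝ) γ.len ∧ s ≤ t ∧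
    γ.toFun s = p ∧ γ.toFun t = q

end GeodesicSegment

/-- A geodesic metric space: every two points are joined by a geodesic segment. -/
def IsGeodesicSpace (X : Type*) [MetricSpace X] : Prop :=
  ∀ x y : X, ∃ γ : GeodesicSegment X, γ.initial = x ∧ γ.terminal = y

/-- δ-hyperbolicity via slim triangles: each side of a geodesic triangle lies in the
closed δ-neighborhood of the union of the other two sides. -/
def IsDeltaHyperbolic (X : Type*) [MetricSpace X] (δ : ℝ) : Prop :=
  ∀ γ₁ γ₂ γ₃ : GeodesicSegment X,
    γ₁.initial = γ₃.initial → γ₁.terminal = γ₂.initial → γ₂.terminal = γ₃.terminal →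
    γ₃.seg ⊆ Metric.cthickening δ (γ₁.seg ∪ γ₂.seg)

variable {X : Type*} [MetricSpace X]

/-- The closest point projection of `x` to (the image of) the geodesic `γ`. -/
def proj (γ : GeodesicSegment X) (x : X) : Set X :=
  {p | p ∈ γ.seg ∧ dist x p = Metric.infDist x γ.seg}

/-- The closest point projection of a set `A` to the geodesic `γ`. -/
def projSet (γ : GeodesicSegment X) (A : Set X) : Set X :=
  ⋃ a ∈ A, proj γ a

/-- The ordered pair of oriented geodesic segments `(γ, η)` is `K`-aligned. -/
def AlignedPair (K : ℝ) (γ η : GeodesicSegment X) : Prop :=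
  Metric.diam (projSet γ η.seg ∪ {γ.terminal}) < K ∧
  Metric.diam (projSet η γ.seg ∪ {η.initial}) < K

/-- A sequence of oriented geodesic segments is `K`-aligned if each consecutive
pair is `K`-aligned. -/
def AlignedSeq (K : ℝ) (l : List (GeodesicSegment X)) : Prop :=
  l.Chain' (AlignedPair K)

/-- The Gromov product `(y, z)_x`. -/
noncomputable def gromovProd (x y z : X) : ℝ := (dist y x + dist x z - dist y z) / 2

/-! ### Word metric -/

variable {G : Type*} [Group G]

/-- The word length of `g` with respect to the (symmetrized) generating set `S`. -/
noncomputable def wordLength (S : Finset G) (g : G) : ℕ :=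
  sInf {n | ∃ l : List G, l.length = n ∧ (∀ x ∈ l, x ∈ S ∨ x⁻¹ ∈ S) ∧ l.prod = g}

/-- The word metric on `G` with respect to `S`. -/
noncomputable def wordDist (S : Finset G) (g h : G) : ℕ := wordLength S (g⁻¹ * h)

/-- The ball of radius `r` in the word metric, centered at the identity. -/
def ball (S : Finset G) (r : ℝ) : Set G := {g | (wordLength S g : ℝ) ≤ r}

/-- `G` has no cyclic subgroup of finite index. -/
def NonVirtuallyCyclic (G : Type*) [Group G] : Prop :=
  ¬ ∃ H : Subgroup G, H.FiniteIndex ∧ IsCyclic H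

/-! ### Isometric actions, loxodromics, WPD -/

/-- `g` is a loxodromic isometry for the action `ρ` with basepoint `x0`: the asymptotic
translation length `τ_X(g) = lim dist x0 (g^n x0) / n` exists and is positive. -/
def IsLoxodromic (ρ : G → X → X) (x0 : X) (g : G) : Prop :=
  ∃ τ : ℝ, 0 < τ ∧
    Filter.Tendsto (fun n : ℕ => dist x0 (ρ (g ^ n) x0) / n) Filter.atTop (nhds τ)

/-- The WPD (weak proper discontinuity) property of `g` for the action `ρ` with
basepoint `x0`. -/
def HasWPD (ρ : G → X → X) (x0 : X) (g : G) : Prop :=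
  ∀ K : ℝ, 0 < K → ∃ N M : ℕ,
    {h : G | dist x0 (ρ h x0) < K ∧ dist (ρ (g ^ N) x0) (ρ h (ρ (g ^ N) x0)) < K}.Finite ∧
    {h : G | dist x0 (ρ h x0) < K ∧ dist (ρ (g ^ N) x0) (ρ h (ρ (g ^ N) x0)) < K}.ncard < M

/-- The list of translated geodesics `h 1 • Υ, …, h m • Υ`. -/
def transList (ρ : G → X → X) (hisom : ∀ g : G, Isometry (ρ g))
    (Υ : GeodesicSegment X) (h : ℕ → G) (m : ℕ) : List (GeodesicSegment X) :=
  (List.range m).map fun i => Υ.translate (ρ (h (i + 1))) (hisom _)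

/-- The specification of the constant `E₀` from Fact 2.7 (Bestvina–Fujiwara):
(i) Gromov product bounds, (ii) the WPD-type conclusion for large projections. -/
def E0Spec (S : Finset G) (ρ : G → X → X) (x0 : X) (φ : G) (E0 : ℝ) : Prop :=
  0 < E0 ∧
  (∀ g : G, ∃ s t : G, (s ∈ S ∨ s = 1) ∧ (t ∈ S ∨ t = 1) ∧
    (∀ i : ℤ, 0 < i → gromovProd x0 (ρ (φ ^ i) x0) (ρ (s * g) x0) ≤ E0) ∧
    (∀ j : ℤ, j < 0 → gromovProd x0 (ρ (φ ^ j) x0) (ρ (t * g) x0) ≤ E0)) ∧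
  (∀ n : ℕ, 0 < n → ∀ g : G, ∀ γ : GeodesicSegment X,
    γ.initial = x0 → γ.terminal = ρ (φ ^ n) x0 →
    ∀ p ∈ proj γ (ρ g x0), ∀ q ∈ proj γ (ρ (g * φ ^ n) x0),
      γ.Before p q → E0 < dist p q →
      ∃ i j : ℕ, i ≤ n ∧ j ≤ n ∧ (wordDist S (φ ^ i) (g * φ ^ j) : ℝ) < E0)

/-- The set `V_{L,ε}(n)`. Here `Υ` is the chosen geodesic `Υ_L = [x₀, φ^L x₀]`. -/
def Vset (S : Finset G) (ρ : G → X → X) (hisom : ∀ g : G, Isometry (ρ g)) (x0 : X)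
    (δ E0 : ℝ) (Υ : GeodesicSegment X) (ε : ℝ) (n : ℕ) : Set G :=
  {g | g ∈ ball S (n:ℝ) ∧ ∃ h : ℕ → G,
    AlignedSeq (6 * E0 + 300 * δ)
      ([GeodesicSegment.point x0] ++ transList ρ hisom Υ h ⌈ε * (n:ℝ)⌉₊ ++
        [GeodesicSegment.point (ρ g x0)])}

/-- The set `W_{L,ε}(n)`. Here `Υ` is the chosen geodesic `Υ_L = [x₀, φ^L x₀]`. -/
def Wset (S : Finset G) (ρ : G → X → X) (hisom : ∀ g : G, Isometry (ρ g)) (x0 : X)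
    (δ E0 : ℝ) (Υ : GeodesicSegment X) (ε : ℝ) (n : ℕ) : Set G :=
  {g | g ∈ ball S (n:ℝ) ∧ ∃ h : ℕ → G,
    AlignedSeq (6 * E0 + 360 * δ)
      ([GeodesicSegment.point x0] ++ transList ρ hisom Υ h ⌈ε * (n:ℝ)⌉₊ ++
        [GeodesicSegment.point (ρ g x0)]) ∧
    AlignedPair (6 * E0 + 360 * δ) (GeodesicSegment.point (ρ g⁻¹ x0))
      (Υ.translate (ρ (h 1)) (hisom _)) ∧
    AlignedPair (6 * E0 + 360 * δ) (Υ.translate (ρ (h ⌈ε * (n:ℝ)⌉₊)) (hisom _))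
      (GeodesicSegment.point (ρ (g ^ 2) x0))}

/-- The set `BAD_{L,ε}(n)`. -/
def BADset (S : Finset G) (ρ : G → X → X) (hisom : ∀ g : G, Isometry (ρ g)) (x0 : X)
    (δ E0 : ℝ) (Υ : GeodesicSegment X) (ε : ℝ) (n : ℕ) : Set G :=
  ball S (n:ℝ) \ (ball S ((⌊(0.9:ℝ) * (n:ℝ)⌋₊ : ℕ) : ℝ) ∪ Vset S ρ hisom x0 δ E0 Υ ε n)

/-! ### Paths in the word metric -/

/-- `P` is a `d_S`-path connecting `a` to `b`. -/
noncomputable def IsPathFrom (S : Finset G) (P : List G) (a b : G) : Prop :=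
  P ≠ [] ∧ P.Chain' (fun u v => wordDist S u v = 1) ∧ P.head? = some a ∧ P.getLast? = some b

/-- The distance `d_S(P, g)` from a path `P` to a group element `g`. -/
noncomputable def pathDist (S : Finset G) (P : List G) (g : G) : ℕ :=
  sInf {d | ∃ v ∈ P, d = wordDist S v g}

/-- A left-invariant pseudo-metric on a group satisfying the four-point hyperbolicity condition. -/
structure HypDist (G : Type*) [Group G] where
  d : G → G → ℝ
  δ : ℝ
  δ_nonneg : 0 ≤ δ
  d_self : ∀ x, d x x = 0
  d_comm : ∀ x y, d x y = d y x
  d_tri : ∀ x y z, d x z ≤ d x y + d y z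
  d_mul : ∀ g x y, d (g * x) (g * y) = d x y
  four : ∀ x y z w, d x y + d z w ≤ d x z + d y w + δ ∨ d x y + d z w ≤ d x w + d y z + δ

namespace HypDist

variable {G : Type*} [Group G] (H : HypDist G)

/-- The Gromov product of `x` and `y` at `o`. -/
noncomputable def gp (o x y : G) : ℝ := (H.d o x + H.d o y - H.d x y) / 2

lemma d_nonneg (x y : G) : 0 ≤ H.d x y := by
  have h1 := H.d_tri x y x
  have h2 := H.d_comm x y
  have h3 := H.d_self x
  linarith

lemma d_one_inv (x : G) : H.d 1 x⁻¹ = H.d 1 x := by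
  have h := H.d_mul x 1 x⁻¹
  rw [mul_one, mul_inv_cancel, H.d_comm x 1] at h
  exact h.symm

lemma d_one_mul (x y : G) : H.d 1 (x * y) ≤ H.d 1 x + H.d 1 y := by
  have h := H.d_tri 1 x (x * y)
  have h2 := H.d_mul x 1 y
  rw [mul_one] at h2
  linarith

lemma d_inv_mul (x y : G) : H.d 1 (x⁻¹ * y) = H.d x y := by
  have h := H.d_mul x⁻¹ x y
  rwa [inv_mul_cancel] at h

lemma d_self_mul (x y : G) : H.d x (x * y) = H.d 1 y := by
  have h := H.d_mul x 1 y
  rwa [mul_one] at h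

lemma d_mul_self (x y : G) : H.d (x * y) x = H.d 1 y := by
  rw [H.d_comm, H.d_self_mul]

lemma gp_comm (o x y : G) : H.gp o x y = H.gp o y x := by
  unfold gp
  rw [H.d_comm x y]
  ring

lemma gp_mul (g o x y : G) : H.gp (g * o) (g * x) (g * y) = H.gp o x y := by
  simp only [gp, H.d_mul]

lemma gp_nonneg (o x y : G) : 0 ≤ H.gp o x y := by
  unfold gp
  have h1 := H.d_tri x o y
  have h2 := H.d_comm x o
  linarith

lemma gp_le_left (o x y : G) : H.gp o x y ≤ H.d o x := by
  unfold gp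
  have h1 := H.d_tri o x y
  linarith

lemma gp_le_right (o x y : G) : H.gp o x y ≤ H.d o y := by
  rw [gp_comm]
  exact H.gp_le_left o y x

lemma gp_add_gp (o x y : G) : H.gp o x y + H.gp x o y = H.d o x := by
  unfold gp
  rw [H.d_comm x o]
  ring

lemma gp_tri (o x y z : G) : H.gp o x y ≤ H.gp o x z + H.δ ∨ H.gp o y z ≤ H.gp o x z + H.δ := by
  have hδ := H.δ_nonneg
  unfold gp
  have h1 := H.d_comm x o
  have h2 := H.d_comm z o
  have h3 := H.d_comm z y
  rcases H.four x z o y with h | h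
  · right; linarith
  · left; linarith

lemma gp_change_base (o o' x y : G) : H.gp o x y ≤ H.gp o' x y + H.d o o' := by
  unfold gp
  have h1 := H.d_tri o o' x
  have h2 := H.d_tri o o' y
  linarith

lemma gp_change_left (o x x' y : G) : H.gp o x y ≤ H.gp o x' y + H.d x x' := by
  unfold gp
  have h1 := H.d_tri o x' x
  have h2 := H.d_tri x' x y
  have h3 := H.d_comm x x'
  linarith

lemma gp_change_right (o x y y' : G) : H.gp o x y ≤ H.gp o x y' + H.d y y' := by
  rw [H.gp_comm o x y, H.gp_comm o x y']
  exact H.gp_change_left o y y' x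

/-- If `o` is close to `[x, y]`, `z` is far beyond `y` and `y` is close to `[o, z]`, then `o` is
close to `[x, z]`. -/
lemma gp_extend {o x y z : G} {C : ℝ} (h : H.gp o x y ≤ C) (hz : C + H.δ < H.gp o z y) :
    H.gp o x z ≤ C + H.δ := by
  rcases H.gp_tri o x z y with h1 | h1
  · linarith
  · linarith

/-- `y` lies within error `C` at position `q` of a geodesic from `P` to `Q`. -/
def On (P Q : G) (C q : ℝ) (y : G) : Prop :=
  H.d P y ≤ q + C ∧ H.d y Q ≤ H.d P Q - q + C

variable {H}

lemma On.mono {P Q : G} {C C' q : ℝ} {y : G} (h : H.On P Q C q y) (hC : C ≤ C') :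
    H.On P Q C' q y :=
  ⟨by linarith [h.1], by linarith [h.2]⟩

lemma On.swap {P Q : G} {C q : ℝ} {y : G} (h : H.On P Q C q y) :
    H.On Q P C (H.d P Q - q) y := by
  have h1 := H.d_comm Q P
  have h2 := H.d_comm Q y
  have h3 := H.d_comm P y
  exact ⟨by linarith [h.2], by linarith [h.1]⟩

lemma On.le_left {P Q : G} {C q : ℝ} {y : G} (h : H.On P Q C q y) : q - C ≤ H.d P y := by
  have := H.d_tri P y Q
  linarith [h.2]

lemma On.le_right {P Q : G} {C q : ℝ} {y : G} (h : H.On P Q C q y) :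
    H.d P Q - q - C ≤ H.d y Q := by
  have := H.d_tri P y Q
  linarith [h.1]

lemma On.dist_le {P Q : G} {C C' q q' : ℝ} {y y' : G} (h : H.On P Q C q y)
    (h' : H.On P Q C' q' y') : H.d y y' ≤ |q - q'| + C + C' + H.δ := by
  have h1 := H.d_comm P y
  have h2 := H.d_comm P y'
  have h3 := le_abs_self (q - q')
  have h4 := neg_abs_le (q - q')
  have h5 := H.d_comm P Q
  rcases H.four y y' P Q with h0 | h0
  · linarith [h.1, h.2, h'.1, h'.2]
  · have h6 := H.d_comm y' P
    linarith [h.1, h.2, h'.1, h'.2]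

lemma On.gp_le {P Q : G} {C q₁ q₂ q₃ : ℝ} {y₁ y₂ y₃ : G} (h₁ : H.On P Q C q₁ y₁)
    (h₂ : H.On P Q C q₂ y₂) (h₃ : H.On P Q C q₃ y₃) (h12 : q₁ ≤ q₂) (h23 : q₂ ≤ q₃) :
    H.gp y₂ y₁ y₃ ≤ 3 * C + H.δ := by
  have a := h₂.dist_le h₁
  have b := h₂.dist_le h₃
  have c := H.d_tri P y₁ y₃
  have e := h₃.le_left
  rw [abs_of_nonneg (by linarith)] at a
  rw [abs_of_nonpos (by linarith)] at b
  unfold gp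
  linarith [h₁.1]

/-- Half-spaces are quasi-convex. -/
lemma gp_convex {o p y y₁ y₂ : G} {c C : ℝ} (hC : 0 ≤ C) (hc : 0 ≤ c)
    (h₁ : H.gp o p y₁ ≤ c) (h₂ : H.gp o p y₂ ≤ c)
    (hy : H.gp y y₁ y₂ ≤ C) : H.gp o p y ≤ C + 2 * c + 2 * H.δ := by
  have hδ := H.δ_nonneg
  rcases H.gp_tri o p y y₁ with h | h
  · linarith
  rcases H.gp_tri o p y y₂ with h' | h'
  · linarith
  have h3 := H.gp_le_right o p y
  have h4 := H.d_tri y₁ o y₂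
  have h5 := H.d_comm y₁ o
  unfold gp at *
  linarith

/-- An isometry folding the end of `[P, Q]` back to its beginning acts as a reflection. -/
lemma On.reflect {P Q a : G} {e E α α' κ q : ℝ} {y : G} (f : G)
    (ha : H.On P Q e α a) (ha' : H.On P Q e α' (f * a)) (hκ : κ ≤ H.gp (f * a) (f * Q) P)
    (hy : H.On P Q E q y) (hq : α ≤ q) (hq' : q ≤ α + κ) :
    H.On P Q (E + 2 * e + 2 * H.δ) (α + α' - q) (f * y) := by
  have hδ := H.δ_nonneg
  have h1 := hy.dist_le ha
  rw [abs_of_nonneg (by linarith)] at h1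
  have h2 := H.d_tri (f * y) (f * a) Q
  rw [H.d_mul] at h2
  refine ⟨?_, by linarith [ha'.2]⟩
  have h3 := H.d_mul f a Q
  have h4 := H.d_mul f y Q
  have h5 := H.d_mul f y a
  have h6 := H.d_comm P (f * a)
  have h7 := H.d_comm P (f * Q)
  have h8 := H.d_comm (f * a) (f * y)
  have h9 := ha.le_right
  have h10 := H.d_tri P a Q
  unfold gp at hκ
  rcases H.four P (f * y) (f * a) (f * Q) with h0 | h0
  · linarith [ha'.1, hy.2, ha.1]
  · linarith [ha'.1, hy.2, ha.1]

/-- The inverse of a folding isometry acts as the same reflection. -/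
lemma On.reflect_inv {P Q a : G} {e E α α' κ q : ℝ} {y : G} (f : G)
    (ha : H.On P Q e α a) (ha' : H.On P Q e α' (f * a)) (hκ : κ ≤ H.gp (f * a) (f * Q) P)
    (hy : H.On P Q E q y) (hq : q ≤ α') (hq' : α' - κ ≤ q) :
    H.On P Q (E + 2 * e + 2 * H.δ) (α + α' - q) (f⁻¹ * y) := by
  have hc := H.d_comm Q P
  have key := On.reflect (H := H) (κ := κ) f⁻¹ ha'.swap (by simpa using ha.swap)
    (by
      rw [← H.gp_mul f]
      simp only [mul_inv_cancel_left]
      rwa [H.gp_comm])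
    hy.swap (by linarith) (by linarith)
  have := key.swap
  convert this using 1
  linarith

end HypDist

namespace HypDist

variable {G : Type*} [Group G] {H : HypDist G}

lemma gp_self (o x : G) : H.gp o o x = 0 := by
  unfold gp
  rw [H.d_self]
  ring

lemma gp_self_right (o x : G) : H.gp o x o = 0 := by
  rw [gp_comm, gp_self]

lemma gp_pow_succ_inv (a : G) (n : ℕ) :
    H.gp 1 (a⁻¹ ^ (n + 1)) a⁻¹ = H.d 1 a - H.gp 1 (a⁻¹ ^ n) a := by
  have h1 := H.gp_add_gp 1 a⁻¹ (a⁻¹ ^ (n + 1))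
  have h2 := H.gp_mul a⁻¹ 1 a (a⁻¹ ^ n)
  rw [← pow_succ', inv_mul_cancel, mul_one] at h2
  rw [H.d_one_inv] at h1
  rw [gp_comm, H.gp_comm 1 (a⁻¹ ^ n)]
  linarith

lemma gp_pow_inv_le {a : G} {C : ℝ} (h : H.gp 1 a⁻¹ a ≤ C) (ha : 2 * C + 2 * H.δ < H.d 1 a)
    (n : ℕ) : H.gp 1 (a⁻¹ ^ n) a ≤ C + H.δ := by
  have hδ := H.δ_nonneg
  induction n with
  | zero =>
    have := H.gp_nonneg 1 a⁻¹ a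
    rw [pow_zero, gp_self]
    linarith
  | succ n ih =>
    rw [H.gp_comm]
    refine H.gp_extend (y := a⁻¹) (by rwa [H.gp_comm]) ?_
    rw [gp_pow_succ_inv]
    linarith

/-- An element displacing the basepoint far without backtracking has quasi-geodesic powers. -/
lemma gp_pow_pow_le {a : G} {C : ℝ} (h : H.gp 1 a⁻¹ a ≤ C) (ha : 2 * C + 3 * H.δ < H.d 1 a)
    (n m : ℕ) : H.gp 1 (a⁻¹ ^ n) (a ^ m) ≤ C + 2 * H.δ := by
  have hδ := H.δ_nonneg
  have hC := (H.gp_nonneg 1 a⁻¹ a).trans h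
  rcases m with _ | m
  · rw [pow_zero, gp_self_right]
    linarith
  have h1 := gp_pow_inv_le h (by linarith) n
  have h2 := gp_pow_inv_le (a := a⁻¹) (C := C) (by rwa [inv_inv, gp_comm])
    (by rw [H.d_one_inv]; linarith) m
  have h3 := H.gp_pow_succ_inv a⁻¹ m
  rw [inv_inv] at h2 h3
  rw [H.d_one_inv] at h3
  have := H.gp_extend (C := C + H.δ) (o := 1) (x := a⁻¹ ^ n) (y := a) (z := a ^ (m + 1)) h1
    (by linarith)
  linarith

lemma le_d_pow {a : G} {C : ℝ} (h : H.gp 1 a⁻¹ a ≤ C) (ha : 2 * C + 2 * H.δ < H.d 1 a)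
    (n : ℕ) : n * (H.d 1 a - 2 * C - 2 * H.δ) ≤ H.d 1 (a ^ n) := by
  induction n with
  | zero => simp [H.d_self]
  | succ n ih =>
    have h1 := gp_pow_inv_le h ha n
    have h2 := H.gp_mul (a ^ n) 1 (a⁻¹ ^ n) a
    rw [inv_pow, mul_inv_cancel, mul_one, ← pow_succ, ← inv_pow] at h2
    rw [← h2] at h1
    unfold gp at h1
    rw [H.d_comm _ 1, pow_succ, H.d_self_mul] at h1
    rw [pow_succ]
    push_cast
    linarith

lemma d_pow_le (a : G) (n : ℕ) : H.d 1 (a ^ n) ≤ n * H.d 1 a := by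
  induction n with
  | zero => simp [H.d_self]
  | succ n ih =>
    rw [pow_succ]
    push_cast
    linarith [H.d_one_mul (a ^ n) a]

end HypDist

namespace HypDist

variable {G : Type*} [Group G] {H : HypDist G}

/-- An isometry moves a point of `[x, z]` about as little as it moves `x` and `z`. -/
lemma d_mul_le_of_gp_le {x y z k : G} {c K : ℝ} (hy : H.gp y x z ≤ c)
    (hx : H.d x (k * x) ≤ K) (hz : H.d z (k * z) ≤ K) :
    H.d y (k * y) ≤ K + 2 * c + H.δ := by
  have h1 := H.d_mul k y z
  have h2 := H.d_mul k y x
  have h3 := H.d_tri (k * y) (k * z) z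
  have h4 := H.d_tri (k * y) (k * x) x
  have h5 := H.d_comm z (k * z)
  have h6 := H.d_comm x (k * x)
  unfold gp at hy
  rcases H.four y (k * y) x z with h | h <;> linarith

/-- `ψ` translates along a quasi-axis through the identity, with the WPD property. -/
structure IsAxis (H : HypDist G) (ψ : G) (c η : ℝ) : Prop where
  η_pos : 0 < η
  str : ∀ n m : ℕ, H.gp 1 (ψ⁻¹ ^ n) (ψ ^ m) ≤ c
  grow : ∀ n : ℕ, n * η ≤ H.d 1 (ψ ^ n)
  wpd : ∀ K : ℝ, ∃ N₁ : ℕ, ∀ N ≥ N₁, {k | H.d 1 k ≤ K ∧ H.d (ψ ^ N) (k * ψ ^ N) ≤ K}.Finite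

lemma IsAxis.c_nonneg {ψ : G} {c η : ℝ} (h : H.IsAxis ψ c η) : 0 ≤ c :=
  (H.gp_nonneg _ _ _).trans (h.str 0 0)

lemma d_inv_pow (ψ : G) (n : ℕ) : H.d 1 (ψ⁻¹ ^ n) = H.d 1 (ψ ^ n) := by
  rw [inv_pow, H.d_one_inv]

lemma IsAxis.inv {ψ : G} {c η : ℝ} (h : H.IsAxis ψ c η) : H.IsAxis ψ⁻¹ c η where
  η_pos := h.η_pos
  str n m := by
    rw [inv_inv, gp_comm]
    exact h.str m n
  grow n := by
    rw [d_inv_pow]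
    exact h.grow n
  wpd K := by
    obtain ⟨N₁, hN⟩ := h.wpd K
    refine ⟨N₁, fun N hN' => ?_⟩
    refine Set.Finite.subset ((hN N hN').image fun k => (ψ ^ N)⁻¹ * k * ψ ^ N) ?_
    rintro k ⟨h1, h2⟩
    refine ⟨ψ ^ N * k * (ψ ^ N)⁻¹, ⟨?_, ?_⟩, by group⟩
    · rw [← H.d_mul (ψ ^ N)] at h2
      simpa [mul_assoc] using h2
    · simpa [mul_assoc, H.d_self_mul] using h1

lemma IsAxis.gp_pow_le {ψ : G} {c η : ℝ} (h : H.IsAxis ψ c η) {i n : ℕ} (hi : i ≤ n) :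
    H.gp (ψ ^ i) 1 (ψ ^ n) ≤ c := by
  obtain ⟨m, rfl⟩ := Nat.exists_eq_add_of_le hi
  have := h.str i m
  rw [← H.gp_mul (ψ ^ i)] at this
  simpa [← pow_add] using this

lemma IsAxis.pow_synced {α β k : G} {c η C : ℝ} (h : H.IsAxis β c η)
    (hlen : ∀ n : ℕ, H.d 1 (α ^ n) = H.d 1 (β ^ n)) {i N : ℕ} (hi : i ≤ N)
    (h₁ : H.d 1 k ≤ C) (h₂ : H.d (k * α ^ N) (β ^ N) ≤ C) :
    H.d (k * α ^ i) (β ^ i) ≤ C + 2 * c + H.δ := by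
  have hg := h.gp_pow_le hi
  obtain ⟨m, rfl⟩ := Nat.exists_eq_add_of_le hi
  have a1 := H.d_one_mul k (α ^ i)
  have a2 := H.d_comm 1 (k * α ^ i)
  have a3 := H.d_tri (k * α ^ i) (k * α ^ (i + m)) (β ^ (i + m))
  have a4 := H.d_self_mul (k * α ^ i) (α ^ m)
  have a5 := H.d_self_mul (β ^ i) (β ^ m)
  have a6 := H.d_comm (β ^ i) 1
  have l1 := hlen i
  have l2 := hlen m
  rw [mul_assoc, ← pow_add] at a4
  rw [← pow_add] at a5
  unfold gp at hg
  rcases H.four (k * α ^ i) (β ^ i) 1 (β ^ (i + m)) with h | h <;> linarith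

lemma IsAxis.finite_synced {α β : G} {c η : ℝ} (h : H.IsAxis α c η) (C : ℝ) :
    ∃ N₁ : ℕ, ∀ N ≥ N₁, {k | H.d 1 k ≤ C ∧ H.d (k * α ^ N) (β ^ N) ≤ C}.Finite := by
  obtain ⟨N₁, hN⟩ := h.wpd (2 * C)
  refine ⟨N₁, fun N hN' => ?_⟩
  rcases Set.eq_empty_or_nonempty {k | H.d 1 k ≤ C ∧ H.d (k * α ^ N) (β ^ N) ≤ C} with h0 | ⟨k, hk⟩
  · rw [h0]
    exact Set.finite_empty
  refine Set.Finite.subset ((hN N hN').image fun l => k * l) ?_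
  rintro k' hk'
  refine ⟨k⁻¹ * k', ⟨?_, ?_⟩, by group⟩
  · have := H.d_tri k 1 k'
    rw [H.d_inv_mul]
    linarith [H.d_comm k 1, hk.1, hk'.1]
  · rw [← H.d_mul k]
    have := H.d_tri (k * α ^ N) (β ^ N) (k' * α ^ N)
    rw [H.d_comm (β ^ N)] at this
    have e : k * (k⁻¹ * k' * α ^ N) = k' * α ^ N := by group
    rw [e]
    linarith [hk.2, hk'.2]

/-- Long overlaps of quasi-axes force commensuration. -/
lemma IsAxis.overlap {α β : G} {c η : ℝ} (hα : H.IsAxis α c η) (hβ : H.IsAxis β c η)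
    (hlen : ∀ n : ℕ, H.d 1 (α ^ n) = H.d 1 (β ^ n)) (C : ℝ) :
    ∃ N₀ q : ℕ, ∀ N ≥ N₀, ∀ k, H.d 1 k ≤ C → H.d (k * α ^ N) (β ^ N) ≤ C →
      ∃ b : ℕ, 0 < b ∧ b ≤ q ∧ k * α ^ b = β ^ b * k := by
  obtain ⟨N₁, hN₁⟩ := hα.finite_synced (β := β) (C + 2 * c + H.δ)
  set R := {k | H.d 1 k ≤ C + 2 * c + H.δ ∧ H.d (k * α ^ N₁) (β ^ N₁) ≤ C + 2 * c + H.δ} with hR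
  have hfin : R.Finite := hN₁ N₁ le_rfl
  refine ⟨N₁ + hfin.toFinset.card, hfin.toFinset.card, fun N hN k h₁ h₂ => ?_⟩
  have hmem : ∀ i ≤ hfin.toFinset.card, (β ^ i)⁻¹ * k * α ^ i ∈ R := by
    intro i hi
    have s1 := hβ.pow_synced hlen (i := i) (by omega) h₁ h₂
    have s2 := hβ.pow_synced hlen (i := i + N₁) (by omega) h₁ h₂
    refine ⟨?_, ?_⟩
    · rw [mul_assoc, H.d_inv_mul, H.d_comm]
      exact s1
    · rw [← H.d_mul (β ^ i)]
      simpa [mul_assoc, ← pow_add] using s2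
  obtain ⟨i, hi, j, hj, hij, heq⟩ := Finset.exists_ne_map_eq_of_card_lt_of_maps_to
    (s := Finset.range (hfin.toFinset.card + 1)) (t := hfin.toFinset)
    (f := fun i => (β ^ i)⁻¹ * k * α ^ i) (by simp) (by
      intro i hi
      simp only [Finset.coe_range, Set.mem_Iio] at hi
      simpa using hmem i (by omega))
  simp only [Finset.mem_range] at hi hj
  wlog hlt : i < j generalizing i j
  · exact this j i hij.symm heq.symm hj hi (by omega)
  obtain ⟨b, rfl⟩ := Nat.exists_eq_add_of_le hlt.le
  refine ⟨b, by omega, by omega, ?_⟩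
  simp only [Nat.add_comm i b, pow_add, mul_inv_rev, mul_assoc, mul_right_inj] at heq
  rw [eq_inv_mul_iff_mul_eq, ← mul_assoc, ← mul_assoc, mul_left_inj] at heq
  exact heq.symm

lemma On.of_gp_le {P Q y : G} {c : ℝ} (h : H.gp y P Q ≤ c) : H.On P Q (2 * c) (H.d P y) y := by
  have hn := H.gp_nonneg y P Q
  unfold gp at h hn
  have := H.d_comm P y
  exact ⟨by linarith, by linarith⟩

end HypDist

namespace HypDist

variable {G : Type*} [Group G] {H : HypDist G}

lemma exists_d_pow_two_lt {φ : G} {τ : ℝ} (hτ : 0 < τ)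
    (h : Filter.Tendsto (fun n : ℕ => H.d 1 (φ ^ n) / n) Filter.atTop (nhds τ)) (K : ℝ) :
    ∃ k : ℕ, H.d 1 (φ ^ 2 ^ k) + K < H.d 1 (φ ^ 2 ^ (k + 1)) := by
  by_contra! hcon
  have hle : ∀ k : ℕ, H.d 1 (φ ^ 2 ^ k) ≤ H.d 1 φ + k * K := by
    intro k
    induction k with
    | zero => simp
    | succ k ih =>
      push_cast
      linarith [hcon k]
  have h1 := h.comp (tendsto_pow_atTop_atTop_of_one_lt (r := 2) (by norm_num))
  have h2 : Filter.Tendsto (fun k : ℕ => H.d 1 φ * ((k : ℝ) ^ 0 / 2 ^ k) +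
      K * ((k : ℝ) ^ 1 / 2 ^ k)) Filter.atTop (nhds (H.d 1 φ * 0 + K * 0)) :=
    ((tendsto_pow_const_div_const_pow_of_one_lt 0 (by norm_num)).const_mul _).add
      ((tendsto_pow_const_div_const_pow_of_one_lt 1 (by norm_num)).const_mul _)
  have h3 := le_of_tendsto_of_tendsto' h1 h2 (fun k => by
    have hp : (0 : ℝ) < 2 ^ k := by positivity
    simp only [Function.comp]
    push_cast
    rw [div_le_iff₀ hp]
    have : (H.d 1 φ * ((k : ℝ) ^ 0 / 2 ^ k) + K * ((k : ℝ) ^ 1 / 2 ^ k)) * 2 ^ k =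
        H.d 1 φ + k * K := by
      field_simp
    rw [this]
    exact hle k)
  linarith

/-- A power of a WPD loxodromic element has a quasi-axis. -/
lemma exists_isAxis {φ : G} {τ : ℝ} (hτ : 0 < τ)
    (h : Filter.Tendsto (fun n : ℕ => H.d 1 (φ ^ n) / n) Filter.atTop (nhds τ))
    (hwpd : ∀ K : ℝ, 0 < K → ∃ N : ℕ,
      {k | H.d 1 k < K ∧ H.d (φ ^ N) (k * φ ^ N) < K}.Finite) :
    ∃ ψ c η, H.IsAxis ψ c η := by
  have hδ := H.δ_nonneg
  obtain ⟨k, hk⟩ := exists_d_pow_two_lt hτ h (3 * H.δ)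
  set p := 2 ^ k with hp
  set C := H.gp 1 (φ ^ p)⁻¹ (φ ^ p) with hC
  have hCv : 2 * C = 2 * H.d 1 (φ ^ p) - H.d 1 (φ ^ 2 ^ (k + 1)) := by
    have e : H.d (φ ^ p)⁻¹ (φ ^ p) = H.d 1 (φ ^ 2 ^ (k + 1)) := by
      rw [← H.d_mul (φ ^ p), mul_inv_cancel, ← pow_add, hp]
      congr 2
      ring
    rw [hC, gp, H.d_one_inv, e]
    ring
  have hlt : 2 * C + 3 * H.δ < H.d 1 (φ ^ p) := by linarith
  have hstr := gp_pow_pow_le hC.symm.le hlt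
  refine ⟨φ ^ p, C + 2 * H.δ, H.d 1 (φ ^ p) - 2 * C - 2 * H.δ, by linarith, hstr,
    le_d_pow hC.symm.le (by linarith), fun K => ?_⟩
  set K' := max K 0 + 2 * (C + 2 * H.δ) + H.δ + 2 * (p * H.d 1 φ) + 1 with hK'
  have hC0 : 0 ≤ C := H.gp_nonneg _ _ _
  have hφ := H.d_nonneg 1 φ
  have hm := le_max_right K 0
  have hm' := le_max_left K 0
  obtain ⟨N, hN⟩ := hwpd K' (by positivity)
  refine ⟨N, fun N' hN' => hN.subset ?_⟩
  rintro x ⟨hx1, hx2⟩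
  have hpp : 0 < p := by positivity
  have hj : N / p ≤ N' := (Nat.div_le_self N p).trans hN'
  have hg : H.gp ((φ ^ p) ^ (N / p)) 1 ((φ ^ p) ^ N') ≤ C + 2 * H.δ := by
    obtain ⟨m, hm⟩ := Nat.exists_eq_add_of_le hj
    have := hstr (N / p) m
    rw [← H.gp_mul ((φ ^ p) ^ (N / p))] at this
    rw [hm]
    simpa [pow_add] using this
  have h1 := d_mul_le_of_gp_le (k := x) (K := max K 0) hg (by rw [mul_one]; linarith)
    (by linarith)
  have hnn : (0:ℝ) ≤ p * H.d 1 φ := by positivity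
  refine ⟨by linarith, ?_⟩
  have e : φ ^ N = (φ ^ p) ^ (N / p) * φ ^ (N % p) := by
    rw [← pow_mul, ← pow_add, Nat.div_add_mod]
  have h2 : H.d 1 (φ ^ (N % p)) ≤ p * H.d 1 φ := by
    refine (d_pow_le φ (N % p)).trans ?_
    have : ((N % p : ℕ) : ℝ) ≤ p := by exact_mod_cast (Nat.mod_lt N hpp).le
    gcongr
  have h3 := H.d_tri (φ ^ N) ((φ ^ p) ^ (N / p)) (x * φ ^ N)
  have h4 := H.d_tri ((φ ^ p) ^ (N / p)) (x * (φ ^ p) ^ (N / p)) (x * φ ^ N)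
  rw [H.d_mul] at h4
  rw [H.d_comm (φ ^ N) ((φ ^ p) ^ (N / p))] at h3
  have h5 : H.d ((φ ^ p) ^ (N / p)) (φ ^ N) = H.d 1 (φ ^ (N % p)) := by
    rw [e, H.d_self_mul]
  linarith

lemma On.pow {α : G} {c η : ℝ} (h : H.IsAxis α c η) {i n : ℕ} (hi : i ≤ n) :
    H.On 1 (α ^ n) (2 * c) (H.d 1 (α ^ i)) (α ^ i) :=
  On.of_gp_le (h.gp_pow_le hi)

/-- If a translate of a quasi-axis fellow-travels a quasi-axis for long, this is realized by a
uniformly small element. -/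
lemma IsAxis.exists_overlap {α β : G} {c η : ℝ} (hα : H.IsAxis α c η) (hβ : H.IsAxis β c η)
    (hlen : ∀ n : ℕ, H.d 1 (β ^ n) = H.d 1 (α ^ n)) (s : G) (N : ℕ) :
    ∃ L : ℝ, ∀ n m : ℕ, L < H.gp 1 (α ^ n) (s * β ^ m) → ∃ i j : ℕ,
      H.d 1 ((α ^ i)⁻¹ * s * β ^ j) ≤ H.d 1 α + 6 * c + 7 * H.δ ∧
      H.d ((α ^ i)⁻¹ * s * β ^ j * β ^ N) (α ^ N) ≤ H.d 1 α + 6 * c + 7 * H.δ := by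
  have hδ := H.δ_nonneg
  have hc := hα.c_nonneg
  have hs := H.d_nonneg 1 s
  have hα0 := H.d_nonneg 1 α
  have hβα : H.d 1 β = H.d 1 α := by simpa using hlen 1
  obtain ⟨j, hj⟩ := exists_nat_gt ((H.d 1 s + c + H.δ) / η)
  rw [div_lt_iff₀ hβ.η_pos] at hj
  refine ⟨H.d 1 s + (j + N) * H.d 1 α + (N + 1) * H.d 1 α, fun n m hL => ?_⟩
  have hNα : 0 ≤ N * H.d 1 α := by positivity
  have hjα : 0 ≤ j * H.d 1 α := by positivity
  have hpt : ∀ l m, j ≤ l → l ≤ m → H.gp (s * β ^ l) 1 (s * β ^ m) ≤ c + H.δ := by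
    intro l m hjl hlm
    rw [gp_comm]
    refine H.gp_extend (y := s) ?_ ?_
    · have := hβ.gp_pow_le hlm
      rw [← H.gp_mul s, mul_one, gp_comm] at this
      exact this
    · have h1 := H.gp_add_gp (s * β ^ l) s 1
      have h2 := H.gp_le_right s (s * β ^ l) 1
      have h3 := hβ.grow l
      have h4 : (j : ℝ) * η ≤ l * η := by
        have := hβ.η_pos
        gcongr
      rw [H.d_mul_self] at h1
      rw [H.d_comm] at h2
      rw [gp_comm]
      linarith
  have hZ : H.gp 1 (α ^ n) (s * β ^ m) ≤ H.d 1 s + m * H.d 1 α := by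
    refine (H.gp_le_right _ _ _).trans ?_
    have := d_pow_le (H := H) β m
    rw [hβα] at this
    linarith [H.d_one_mul s (β ^ m)]
  have hW := H.gp_le_left 1 (α ^ n) (s * β ^ m)
  have hm : j + N ≤ m := by
    by_contra! hlt
    have : (m : ℝ) ≤ j + N := by exact_mod_cast hlt.le
    have : m * H.d 1 α ≤ (j + N) * H.d 1 α := by gcongr
    linarith
  have hp : ∀ l ≤ j + N, H.d 1 (s * β ^ l) ≤ H.d 1 s + (j + N) * H.d 1 α := by
    intro l hl
    have h1 := d_pow_le (H := H) β l
    rw [hβα] at h1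
    have h2 : (l : ℝ) ≤ j + N := by exact_mod_cast hl
    have h3 : l * H.d 1 α ≤ (j + N) * H.d 1 α := by gcongr
    linarith [H.d_one_mul s (β ^ l)]
  have hon : ∀ l, j ≤ l → l ≤ j + N →
      H.On 1 (α ^ n) (2 * c + 4 * H.δ) (H.d 1 (s * β ^ l)) (s * β ^ l) := by
    intro l h1 h2
    have h3 := hpt l m h1 (by omega)
    have h4 := hp l h2
    have h5 := H.gp_add_gp 1 (s * β ^ l) (s * β ^ m)
    have h6 := H.gp_comm 1 (s * β ^ l) (s * β ^ m)
    have h7 : H.d 1 (s * β ^ l) - c - 2 * H.δ ≤ H.gp 1 (α ^ n) (s * β ^ l) := by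
      rcases H.gp_tri 1 (α ^ n) (s * β ^ m) (s * β ^ l) with h | h <;> linarith
    refine ⟨by linarith, ?_⟩
    unfold gp at h7
    rw [H.d_comm]
    linarith
  have hex : ∃ i, H.d 1 (s * β ^ j) ≤ H.d 1 (α ^ i) :=
    ⟨n, by linarith [hp j (by omega)]⟩
  classical
  set i := Nat.find hex with hi
  have hi1 : H.d 1 (s * β ^ j) ≤ H.d 1 (α ^ i) := Nat.find_spec hex
  have hin : i ≤ n := Nat.find_min' hex (by linarith [hp j (by omega)])
  have hi2 : H.d 1 (α ^ i) ≤ H.d 1 (s * β ^ j) + H.d 1 α := by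
    rcases Nat.eq_zero_or_pos i with h0 | h0
    · rw [h0, pow_zero, H.d_self]
      have := H.d_nonneg 1 (s * β ^ j)
      linarith
    · obtain ⟨i', hi'⟩ := Nat.exists_eq_add_of_lt h0
      have h1 := Nat.find_min hex (m := i') (by omega)
      have h2 := H.d_one_mul (α ^ i') α
      rw [← pow_succ] at h2
      rw [hi', zero_add]
      linarith
  have hiN : i + N ≤ n := by
    by_contra! hlt
    obtain ⟨t, ht⟩ := Nat.exists_eq_add_of_le hin
    have h1 := H.d_one_mul (α ^ i) (α ^ t)
    have h2 := d_pow_le (H := H) α t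
    rw [← pow_add, ← ht] at h1
    have h3 : (t : ℝ) ≤ N := by exact_mod_cast (by omega : t ≤ N)
    have h4 : t * H.d 1 α ≤ N * H.d 1 α := by gcongr
    linarith [hp j (by omega)]
  refine ⟨i, j, ?_, ?_⟩
  · rw [mul_assoc, H.d_inv_mul, H.d_comm]
    have := (hon j le_rfl (by omega)).dist_le (On.pow hα hin)
    rw [abs_of_nonpos (by linarith)] at this
    linarith
  · rw [← H.d_mul (α ^ i)]
    have e : α ^ i * ((α ^ i)⁻¹ * s * β ^ j * β ^ N) = s * β ^ (j + N) := by
      rw [pow_add]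
      group
    rw [e, ← pow_add]
    have h1 := (hon (j + N) (by omega) le_rfl).dist_le (On.pow hα hiN)
    have h2 := hpt j (j + N) le_rfl (by omega)
    have h3 := hα.gp_pow_le (Nat.le_add_right i N)
    have h4 := H.gp_nonneg (s * β ^ j) 1 (s * β ^ (j + N))
    have h5 := H.gp_nonneg (α ^ i) 1 (α ^ (i + N))
    unfold gp at h2 h3 h4 h5
    have h6 : H.d (s * β ^ j) (s * β ^ (j + N)) = H.d 1 (α ^ N) := by
      rw [pow_add, ← mul_assoc, H.d_self_mul, hlen]
    have h7 : H.d (α ^ i) (α ^ (i + N)) = H.d 1 (α ^ N) := by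
      rw [pow_add, H.d_self_mul]
    rw [h6, H.d_comm _ 1] at h2 h4
    rw [h7, H.d_comm _ 1] at h3 h5
    have h8 : |H.d 1 (s * β ^ (j + N)) - H.d 1 (α ^ (i + N))| ≤ H.d 1 α + 2 * c + 2 * H.δ := by
      rw [abs_le]
      constructor <;> linarith
    linarith

end HypDist

namespace HypDist

variable {G : Type*} [Group G] {H : HypDist G}

/-- The element `ψ` or its inverse, according to a sign. -/
def signed (ψ : G) (e : Bool) : G := cond e ψ ψ⁻¹

lemma IsAxis.signed {ψ : G} {c η : ℝ} (h : H.IsAxis ψ c η) (e : Bool) :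
    H.IsAxis (signed ψ e) c η := by
  cases e
  · exact h.inv
  · exact h

lemma d_signed_pow (ψ : G) (e : Bool) (n : ℕ) : H.d 1 (signed ψ e ^ n) = H.d 1 (ψ ^ n) := by
  cases e
  · exact d_inv_pow ψ n
  · rfl

lemma signed_mem_zpowers (ψ : G) (e : Bool) : signed ψ e ∈ Subgroup.zpowers ψ := by
  cases e
  · exact inv_mem (Subgroup.mem_zpowers ψ)
  · exact Subgroup.mem_zpowers ψ

lemma exists_signed_pow (ψ : G) (n : ℤ) : ∃ (e : Bool) (m : ℕ), ψ ^ n = signed ψ e ^ m := by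
  obtain ⟨m, rfl | rfl⟩ := n.eq_nat_or_neg
  · exact ⟨true, m, by simp [HypDist.signed]⟩
  · exact ⟨false, m, by simp [HypDist.signed]⟩

lemma IsAxis.exists_finite_cosets {α β : G} {c η : ℝ} (hα : H.IsAxis α c η)
    (hβ : H.IsAxis β c η) (hlen : ∀ n : ℕ, H.d 1 (β ^ n) = H.d 1 (α ^ n)) :
    ∃ F : Set G, F.Finite ∧ ∀ s : G,
      (∀ L : ℝ, ∃ n m : ℕ, L < H.gp 1 (α ^ n) (s * β ^ m)) →
      ∃ z ∈ F, ∃ w ∈ Subgroup.zpowers α, s = w * z := by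
  set C := H.d 1 α + 6 * c + 7 * H.δ with hC
  obtain ⟨N₀, q, hq⟩ := hβ.overlap hα hlen C
  obtain ⟨N₁, hN₁⟩ := hβ.finite_synced (β := α) C
  set N := max N₀ N₁
  refine ⟨Set.image2 (fun k r => k * β⁻¹ ^ r)
    {k | H.d 1 k ≤ C ∧ H.d (k * β ^ N) (α ^ N) ≤ C} (Set.Iio q),
    (hN₁ N (le_max_right _ _)).image2 _ (Set.finite_Iio q), fun s hs => ?_⟩
  obtain ⟨L, hL⟩ := hα.exists_overlap hβ hlen s N
  obtain ⟨n, m, hnm⟩ := hs L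
  obtain ⟨i, j, h1, h2⟩ := hL n m hnm
  set k := (α ^ i)⁻¹ * s * β ^ j with hk
  obtain ⟨b, hb0, hbq, hb⟩ := hq N (le_max_left _ _) k h1 h2
  refine ⟨k * β⁻¹ ^ (j % b), ⟨k, ⟨h1, h2⟩, j % b, (Nat.mod_lt j hb0).trans_le hbq, rfl⟩,
    α ^ i * ((α ^ b)⁻¹) ^ (j / b),
    mul_mem (pow_mem (Subgroup.mem_zpowers α) _)
      (pow_mem (inv_mem (pow_mem (Subgroup.mem_zpowers α) _)) _), ?_⟩
  have hsc : SemiconjBy k (((β ^ b)⁻¹) ^ (j / b)) (((α ^ b)⁻¹) ^ (j / b)) :=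
    (SemiconjBy.inv_right (show SemiconjBy k (β ^ b) (α ^ b) from hb)).pow_right _
  have e1 : s = α ^ i * (k * (β⁻¹) ^ j) := by
    rw [hk, inv_pow]
    group
  have e2 : (β⁻¹) ^ j = ((β ^ b)⁻¹) ^ (j / b) * β⁻¹ ^ (j % b) := by
    rw [← inv_pow, ← pow_mul, ← pow_add, Nat.div_add_mod]
  rw [e1, e2, ← mul_assoc k, hsc.eq]
  simp only [mul_assoc]

/-- Some translate of a quasi-axis is transverse to it. -/
lemma IsAxis.exists_transverse {ψ : G} {c η : ℝ} (hψ : H.IsAxis ψ c η)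
    (hG : NonVirtuallyCyclic G) :
    ∃ (s : G) (c' : ℝ), ∀ n m : ℤ, H.gp 1 (ψ ^ n) (s * ψ ^ m) ≤ c' := by
  by_contra! hcon
  have hlen : ∀ (e e' : Bool) (n : ℕ),
      H.d 1 (HypDist.signed ψ e' ^ n) = H.d 1 (HypDist.signed ψ e ^ n) := by
    intro e e' n
    rw [d_signed_pow, d_signed_pow]
  choose F hF hFs using fun e e' => (hψ.signed e).exists_finite_cosets (hψ.signed e') (hlen e e')
  refine hG ⟨Subgroup.zpowers ψ, ?_, inferInstance⟩
  have hcov : ∀ s : G, ∃ z ∈ ⋃ e, ⋃ e', F e e', ∃ w ∈ Subgroup.zpowers ψ, s = w * z := by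
    intro s
    have : ∃ e e', ∀ L : ℝ, ∃ n m : ℕ,
        L < H.gp 1 (HypDist.signed ψ e ^ n) (s * HypDist.signed ψ e' ^ m) := by
      by_contra! hb
      choose L hL using hb
      obtain ⟨n, m, hnm⟩ := hcon s (∑ e, ∑ e', |L e e'|)
      obtain ⟨e, n', hn⟩ := exists_signed_pow ψ n
      obtain ⟨e', m', hm⟩ := exists_signed_pow ψ m
      rw [hn, hm] at hnm
      have h1 := hL e e' n' m'
      have h2 : |L e e'| ≤ ∑ e', |L e e'| :=
        Finset.single_le_sum (f := fun e' => |L e e'|) (fun _ _ => abs_nonneg _)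
          (Finset.mem_univ e')
      have h3 : ∑ e', |L e e'| ≤ ∑ e, ∑ e', |L e e'| :=
        Finset.single_le_sum (f := fun e => ∑ e', |L e e'|)
          (fun _ _ => Finset.sum_nonneg fun _ _ => abs_nonneg _) (Finset.mem_univ e)
      linarith [le_abs_self (L e e')]
    obtain ⟨e, e', h⟩ := this
    obtain ⟨z, hz, w, hw, hs⟩ := hFs e e' s h
    refine ⟨z, Set.mem_iUnion₂.2 ⟨e, e', hz⟩, w, ?_, hs⟩
    exact (Subgroup.zpowers_le.2 (signed_mem_zpowers ψ e)) hw
  have hfin : (⋃ e, ⋃ e', F e e').Finite :=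
    Set.finite_iUnion fun e => Set.finite_iUnion fun e' => hF e e'
  have : Finite (G ⧸ Subgroup.zpowers ψ) := by
    refine Set.finite_univ_iff.1
      ((hfin.image fun z => (QuotientGroup.mk z⁻¹ : G ⧸ Subgroup.zpowers ψ)).subset ?_)
    rintro x -
    induction x using QuotientGroup.induction_on with
    | H s =>
      obtain ⟨z, hz, w, hw, hs⟩ := hcov s⁻¹
      refine ⟨z, hz, ?_⟩
      rw [QuotientGroup.eq]
      have : z⁻¹⁻¹ * s = w⁻¹ := by
        rw [← inv_inv s, hs]
        group
      rw [this]
      exact inv_mem hw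
  exact Subgroup.finiteIndex_of_finite_quotient

end HypDist

namespace HypDist

variable {G : Type*} [Group G] {H : HypDist G}

/-- Points at comparable positions of two fellow-travelling geodesics are close. -/
lemma d_le_of_fellow {x x' y y' z z' : G} {A a : ℝ} (hx : H.d x x' ≤ A) (hz : H.d z z' ≤ A)
    (hy : H.gp y x z ≤ a) (hy' : H.gp y' x' z' ≤ a) (hxy : H.d x y = H.d x' y') :
    H.d y y' ≤ 3 * A + 2 * a + H.δ := by
  have hA := (H.d_nonneg x x').trans hx
  unfold gp at hy hy'
  have h1 := H.d_tri y x x'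
  have h2 := H.d_tri y z z'
  have h3 := H.d_tri x x' z'
  have h4 := H.d_tri x z' z
  have h5 := H.d_comm y x
  have h6 := H.d_comm y' x'
  have h7 := H.d_comm z z'
  rcases H.four y y' x' z' with h | h <;> linarith

/-- A segment along which the group acts with prescribed quality `C`: it is long, its coarse
stabilizer is finite, and no group element coarsely reverses it. -/
structure IsProbe (H : HypDist G) (C : ℝ) (b : G) : Prop where
  le : C ≤ H.d 1 b
  fin : {k | H.d 1 k ≤ C ∧ H.d b (k * b) ≤ C}.Finite
  asym : ∀ h, H.d h b ≤ C → C < H.d (h * b) 1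

lemma IsProbe.conj {C D : ℝ} {b s t : G} (h : H.IsProbe (C + 2 * D) b) (hs : H.d 1 s ≤ D)
    (ht : H.d 1 t ≤ D) : H.IsProbe C (s * b * t⁻¹) := by
  have e0 : H.d (s * b * t⁻¹) (s * b) ≤ D := by
    rw [H.d_mul_self, H.d_one_inv]
    exact ht
  have e0' := H.d_comm (s * b * t⁻¹) (s * b)
  have hs1 := H.d_comm 1 s
  refine ⟨?_, ?_, ?_⟩
  · have h1 := H.d_self_mul s b
    have h2 := H.d_tri s 1 (s * b)
    have h3 := H.d_tri 1 (s * b * t⁻¹) (s * b)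
    linarith [h.le]
  · refine (h.fin.image fun k => s * k * s⁻¹).subset ?_
    rintro k ⟨h1, h2⟩
    refine ⟨s⁻¹ * k * s, ⟨?_, ?_⟩, by group⟩
    · have h3 := H.d_tri s 1 (k * s)
      have h4 := H.d_one_mul k s
      rw [mul_assoc, H.d_inv_mul]
      linarith
    · rw [← H.d_mul s]
      have e : s * (s⁻¹ * k * s * b) = k * (s * b) := by group
      have h3 := H.d_tri (s * b) (s * b * t⁻¹) (k * (s * b))
      have h4 := H.d_tri (s * b * t⁻¹) (k * (s * b * t⁻¹)) (k * (s * b))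
      rw [H.d_mul] at h4
      rw [e]
      linarith
  · intro k hk
    by_contra! hcon
    have h1 : H.d (s⁻¹ * k * s) b ≤ C + 2 * D := by
      rw [← H.d_mul s]
      have e : s * (s⁻¹ * k * s) = k * s := by group
      have h3 := H.d_tri (k * s) k (s * b)
      have h4 := H.d_tri k (s * b * t⁻¹) (s * b)
      have h5 := H.d_mul_self k s
      rw [e]
      linarith
    have h2 := h.asym _ h1
    rw [← H.d_mul s, mul_one] at h2
    have e : s * (s⁻¹ * k * s * b) = k * (s * b) := by group
    rw [e] at h2
    have h3 := H.d_tri (k * (s * b)) (k * (s * b * t⁻¹)) s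
    have h4 := H.d_tri (k * (s * b * t⁻¹)) 1 s
    rw [H.d_mul] at h3
    linarith

variable {ψ s : G} {c η c' : ℝ}

lemma IsAxis.gp_pow_transverse_le (hψ : H.IsAxis ψ c η)
    (hs : ∀ n m : ℤ, H.gp 1 (ψ ^ n) (s * ψ ^ m) ≤ c') {m : ℕ}
    (hm : c + H.δ + c' + H.d 1 s < m * η) (n p : ℕ) :
    H.gp 1 (ψ ^ n) ((ψ ^ m)⁻¹ * s⁻¹ * (ψ ^ p)⁻¹) ≤ c + H.δ := by
  refine H.gp_extend (y := (ψ ^ m)⁻¹) ?_ ?_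
  · rw [gp_comm, ← inv_pow]
    exact hψ.str m n
  · have h1 := H.gp_add_gp 1 (ψ ^ m)⁻¹ ((ψ ^ m)⁻¹ * s⁻¹ * (ψ ^ p)⁻¹)
    have h2 := H.gp_mul (ψ ^ m) (ψ ^ m)⁻¹ 1 ((ψ ^ m)⁻¹ * s⁻¹ * (ψ ^ p)⁻¹)
    have h3 := H.gp_mul s 1 (ψ ^ m) (s⁻¹ * (ψ ^ p)⁻¹)
    have h4 := hs (-p) m
    have h5 := H.gp_change_base s 1 (s * ψ ^ m) ((ψ ^ p)⁻¹)
    have h6 := hψ.grow m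
    rw [zpow_neg, zpow_natCast, zpow_natCast, gp_comm] at h4
    simp only [mul_inv_cancel, mul_one, mul_assoc, mul_inv_cancel_left] at h1 h2 h3
    rw [H.d_one_inv] at h1
    rw [H.d_comm] at h5
    rw [gp_comm, mul_assoc]
    linarith

lemma gp_pow_mul_le (hs : ∀ n m : ℤ, H.gp 1 (ψ ^ n) (s * ψ ^ m) ≤ c') (n m : ℕ) :
    H.gp (ψ ^ n) 1 (ψ ^ n * s * ψ ^ m) ≤ c' := by
  have h1 := hs (-n) m
  rw [← H.gp_mul (ψ ^ n)] at h1
  simpa [mul_assoc] using h1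

lemma IsAxis.probe_asym (hψ : H.IsAxis ψ c η)
    (hs : ∀ n m : ℤ, H.gp 1 (ψ ^ n) (s * ψ ^ m) ≤ c') (C : ℝ) :
    ∃ N₀ : ℕ, ∀ N ≥ N₀, ∀ h, H.d h (ψ ^ N * s * ψ ^ (2 * N)) ≤ C →
      C < H.d (h * (ψ ^ N * s * ψ ^ (2 * N))) 1 := by
  have hη := hψ.η_pos
  have hδ := H.δ_nonneg
  set C₂ := 3 * C + 2 * max c' (c + H.δ) + H.δ with hC₂
  set C₃ := 3 * max C (C₂ + H.d 1 s) + 2 * (c + H.δ) + H.δ with hC₃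
  obtain ⟨N₀, q, hq⟩ := hψ.inv.overlap hψ (d_inv_pow ψ) (max C C₂)
  obtain ⟨i₀, hi₀⟩ := exists_nat_gt ((c + H.δ + c' + H.d 1 s) / η)
  rw [div_lt_iff₀ hη] at hi₀
  obtain ⟨l, hl⟩ := exists_nat_gt ((C₂ + C₃ + c') / η)
  rw [div_lt_iff₀ hη] at hl
  refine ⟨N₀ + q * l + i₀, fun N hN h h₁ => ?_⟩
  by_contra! h₂
  set b := ψ ^ N * s * ψ ^ (2 * N) with hb
  obtain ⟨k, rfl⟩ : ∃ k, h = b * k := ⟨b⁻¹ * h, by group⟩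
  have hk : H.d 1 k ≤ C := by
    rw [H.d_mul_self] at h₁
    exact h₁
  have hbk : H.d (k * b) b⁻¹ ≤ C := by
    rw [← H.d_mul b, mul_inv_cancel, ← mul_assoc]
    exact h₂
  have hbinv : ∀ i ≤ N, H.gp (ψ⁻¹ ^ i) 1 b⁻¹ = H.gp 1 (ψ ^ i)
      ((ψ ^ (2 * N - i))⁻¹ * s⁻¹ * (ψ ^ N)⁻¹) := by
    intro i hi
    rw [← H.gp_mul (ψ ^ i)]
    congr 1
    · rw [inv_pow, mul_inv_cancel]
    · rw [mul_one]
    · obtain ⟨t, ht⟩ := Nat.exists_eq_add_of_le (show i ≤ 2 * N by omega)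
      rw [hb, ht, Nat.add_sub_cancel_left, Nat.add_comm i t, pow_add]
      group
  have grow_mono : ∀ m : ℕ, i₀ ≤ m → c + H.δ + c' + H.d 1 s < m * η := by
    intro m hm
    have : (i₀ : ℝ) * η ≤ m * η := by gcongr
    linarith
  have f1 : H.d (k * ψ ^ N) (ψ⁻¹ ^ N) ≤ C₂ := by
    refine d_le_of_fellow (x := k) (x' := 1) (z := k * b) (z' := b⁻¹) (by rwa [H.d_comm]) hbk
      ?_ ?_ ?_
    · have h1 := gp_pow_mul_le hs N (2 * N)
      rw [← H.gp_mul k, mul_one] at h1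
      exact h1.trans (le_max_left _ _)
    · rw [hbinv N le_rfl]
      exact (hψ.gp_pow_transverse_le hs (grow_mono _ (by omega)) N N).trans (le_max_right _ _)
    · rw [H.d_self_mul, d_inv_pow]
  set k₂ := ψ ^ N * k * ψ ^ N with hk₂
  have hk₂' : H.d 1 k₂ ≤ C₂ := by
    have := H.d_mul (ψ ^ N) (k * ψ ^ N) (ψ⁻¹ ^ N)
    rw [inv_pow, mul_inv_cancel, ← mul_assoc, H.d_comm] at this
    rw [hk₂, this, ← inv_pow]
    exact f1
  obtain ⟨b', hb0, hbq, hcomm⟩ := hq N (by nlinarith [Nat.zero_le (q * l)]) k₂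
    (hk₂'.trans (le_max_right _ _)) (by
      have : k₂ * ψ⁻¹ ^ N = ψ ^ N * k := by
        rw [hk₂]
        group
      rw [this, H.d_mul_self]
      exact hk.trans (le_max_left _ _))
  have hbl : b' * l ≤ q * l := Nat.mul_le_mul_right l hbq
  have f2 : H.d (k₂ * s * ψ ^ (b' * l)) (ψ⁻¹ ^ (b' * l)) ≤ C₃ := by
    refine d_le_of_fellow (x := k₂ * s) (x' := 1) (z := k₂ * s * ψ ^ (2 * N))
      (z' := (ψ ^ N)⁻¹ * s⁻¹ * (ψ ^ N)⁻¹) ?_ ?_ ?_ ?_ ?_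
    · refine le_trans ?_ (le_max_right _ _)
      rw [H.d_comm]
      linarith [H.d_one_mul k₂ s]
    · refine le_trans ?_ (le_max_left _ _)
      rw [← H.d_mul (ψ ^ N)] at hbk
      have e1 : ψ ^ N * (k * b) = k₂ * s * ψ ^ (2 * N) := by
        rw [hb, hk₂]
        group
      have e2 : ψ ^ N * b⁻¹ = (ψ ^ N)⁻¹ * s⁻¹ * (ψ ^ N)⁻¹ := by
        rw [hb, two_mul, pow_add]
        group
      rwa [e1, e2] at hbk
    · have h1 := hψ.gp_pow_le (show b' * l ≤ 2 * N by omega)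
      rw [← H.gp_mul (k₂ * s), mul_one] at h1
      linarith
    · have e : H.gp (ψ⁻¹ ^ (b' * l)) 1 ((ψ ^ N)⁻¹ * s⁻¹ * (ψ ^ N)⁻¹) =
          H.gp 1 (ψ ^ (b' * l)) ((ψ ^ (N - b' * l))⁻¹ * s⁻¹ * (ψ ^ N)⁻¹) := by
        rw [← H.gp_mul (ψ ^ (b' * l))]
        congr 1
        · rw [inv_pow, mul_inv_cancel]
        · rw [mul_one]
        · obtain ⟨t, ht⟩ := Nat.exists_eq_add_of_le (show b' * l ≤ N by omega)
          have : (ψ ^ N)⁻¹ = (ψ ^ (b' * l))⁻¹ * (ψ ^ t)⁻¹ := by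
            rw [← mul_inv_rev, ← pow_add, Nat.add_comm t, ht]
          have ht' : N - b' * l = t := by omega
          rw [this, ht']
          group
      rw [e]
      exact hψ.gp_pow_transverse_le hs (grow_mono _ (by omega)) _ _
    · rw [H.d_self_mul, d_inv_pow]
  have hconj : k₂ * ψ ^ (b' * l) * k₂⁻¹ = ψ⁻¹ ^ (b' * l) := by
    have hsc : SemiconjBy k₂ ((ψ⁻¹ ^ b') ^ l)⁻¹ ((ψ ^ b') ^ l)⁻¹ :=
      ((show SemiconjBy k₂ (ψ⁻¹ ^ b') (ψ ^ b') from hcomm).pow_right l).inv_right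
    rw [← pow_mul, ← pow_mul, inv_pow, inv_inv] at hsc
    rw [hsc.eq, mul_inv_cancel_right, inv_pow]
  have f3 : H.d (s * ψ ^ (b' * l)) (ψ ^ (b' * l)) ≤ C₃ + C₂ := by
    have h1 := H.d_mul k₂ (s * ψ ^ (b' * l)) (ψ ^ (b' * l) * k₂⁻¹)
    have e : k₂ * (ψ ^ (b' * l) * k₂⁻¹) = ψ⁻¹ ^ (b' * l) := by
      rw [← hconj, mul_assoc k₂]
    rw [e, ← mul_assoc] at h1
    have h2 := H.d_tri (s * ψ ^ (b' * l)) (ψ ^ (b' * l) * k₂⁻¹) (ψ ^ (b' * l))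
    rw [H.d_mul_self, H.d_one_inv] at h2
    linarith
  have f4 := hs ((b' * l : ℕ) : ℤ) ((b' * l : ℕ) : ℤ)
  rw [zpow_natCast] at f4
  unfold gp at f4
  have f5 := hψ.grow (b' * l)
  have f6 := H.d_tri 1 (s * ψ ^ (b' * l)) (ψ ^ (b' * l))
  have f7 := H.d_comm (s * ψ ^ (b' * l)) (ψ ^ (b' * l))
  have f8 : (l : ℝ) * η ≤ ((b' * l : ℕ) : ℝ) * η := by
    have : l ≤ b' * l := Nat.le_mul_of_pos_left l hb0
    gcongr
  linarith

end HypDist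

namespace HypDist

variable {G : Type*} [Group G] {H : HypDist G} {ψ s : G} {c η c' : ℝ}

lemma IsAxis.isProbe (hψ : H.IsAxis ψ c η)
    (hs : ∀ n m : ℤ, H.gp 1 (ψ ^ n) (s * ψ ^ m) ≤ c') (C : ℝ) :
    ∃ N₀ : ℕ, ∀ N ≥ N₀, H.IsProbe C (ψ ^ N * s * ψ ^ (2 * N)) := by
  have hη := hψ.η_pos
  obtain ⟨N₀, hN₀⟩ := hψ.probe_asym hs C
  obtain ⟨N₁, hN₁⟩ := hψ.wpd (C + 2 * c' + H.δ)
  obtain ⟨N₂, hN₂⟩ := exists_nat_gt ((C + 2 * c') / η)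
  rw [div_lt_iff₀ hη] at hN₂
  refine ⟨max N₀ (max N₁ N₂), fun N hN => ⟨?_, ?_, hN₀ N (le_of_max_le_left hN)⟩⟩
  · have h1 := gp_pow_mul_le hs N (2 * N)
    have h2 := hψ.grow N
    have h3 : (N₂ : ℝ) * η ≤ N * η := by
      have : N₂ ≤ N := le_of_max_le_right (le_of_max_le_right hN)
      gcongr
    have h4 := H.d_nonneg (ψ ^ N) (ψ ^ N * s * ψ ^ (2 * N))
    unfold gp at h1
    rw [H.d_comm _ 1] at h1
    linarith
  · refine (hN₁ N (le_of_max_le_left (le_of_max_le_right hN))).subset ?_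
    rintro k ⟨h1, h2⟩
    have hδ := H.δ_nonneg
    have hc' := (H.gp_nonneg _ _ _).trans (hs 0 0)
    refine ⟨by linarith, ?_⟩
    exact d_mul_le_of_gp_le (gp_pow_mul_le hs N (2 * N)) (by rwa [mul_one]) h2

/-- Three translates of a quasi-axis pairwise transverse at the identity. -/
lemma IsAxis.exists_triple (hψ : H.IsAxis ψ c η)
    (hs : ∀ n m : ℤ, H.gp 1 (ψ ^ n) (s * ψ ^ m) ≤ c') :
    ∃ (t : Fin 3 → G) (c₂ : ℝ), ∀ i j, i ≠ j → ∀ n m : ℤ,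
      H.gp 1 (t i * ψ ^ n) (t j * ψ ^ m) ≤ c₂ := by
  have hη := hψ.η_pos
  have hδ := H.δ_nonneg
  have hc' := (H.gp_nonneg _ _ _).trans (hs 0 0)
  obtain ⟨κ, hκ⟩ := exists_nat_gt ((2 * c' + H.δ) / η)
  rw [div_lt_iff₀ hη] at hκ
  have hκ' := hψ.grow κ
  have h01 : ∀ n m : ℤ, H.gp 1 (ψ ^ n) (ψ ^ κ * s * ψ ^ m) ≤ c' + H.d 1 (ψ ^ κ) := by
    intro n m
    have h1 := hs (n - κ) m
    rw [← H.gp_mul (ψ ^ κ), mul_one, zpow_sub, zpow_natCast, ← mul_assoc, ← mul_assoc] at h1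
    have e : ψ ^ κ * ψ ^ n * (ψ ^ κ)⁻¹ = ψ ^ n := by
      rw [← zpow_natCast]
      group
    rw [e] at h1
    linarith [H.gp_change_base 1 (ψ ^ κ) (ψ ^ n) (ψ ^ κ * s * ψ ^ m)]
  have h12 : ∀ n m : ℤ, H.gp 1 (s * ψ ^ n) (ψ ^ κ * s * ψ ^ m) ≤ c' + H.δ := by
    intro n m
    refine H.gp_extend (y := ψ ^ κ) ?_ ?_
    · rw [gp_comm]
      exact_mod_cast hs κ n
    · have h1 := H.gp_add_gp 1 (ψ ^ κ) (ψ ^ κ * s * ψ ^ m)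
      have h2 := hs (-κ) m
      rw [← H.gp_mul (ψ ^ κ), mul_one, zpow_neg, zpow_natCast, mul_inv_cancel, ← mul_assoc] at h2
      rw [gp_comm]
      linarith
  have hpos := H.d_nonneg 1 (ψ ^ κ)
  refine ⟨![1, s, ψ ^ κ * s], c' + H.d 1 (ψ ^ κ) + H.δ, fun i j hij n m => ?_⟩
  have a1 := hs n m
  have a2 := hs m n
  have b1 := h01 n m
  have b2 := h01 m n
  have d1 := h12 n m
  have d2 := h12 m n
  rw [gp_comm] at a2 b2 d2
  fin_cases i <;> fin_cases j <;> simp at hij ⊢ <;> linarith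

lemma exists_transverse_index {a : Fin 3 → G} {c₂ : ℝ}
    (ha : ∀ i j, i ≠ j → H.gp 1 (a i) (a j) ≤ c₂) (p₁ p₂ : G) :
    ∃ i, H.gp 1 p₁ (a i) ≤ c₂ + H.δ ∧ H.gp 1 p₂ (a i) ≤ c₂ + H.δ := by
  have key : ∀ p i j, i ≠ j → c₂ + H.δ < H.gp 1 p (a i) → H.gp 1 p (a j) ≤ c₂ + H.δ := by
    intro p i j hij hi
    by_contra! hj
    have h1 := ha i j hij
    rw [gp_comm] at hi
    rcases H.gp_tri 1 (a i) p (a j) with h | h <;> linarith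
  by_contra! hcon
  have k1 := key p₁
  have k2 := key p₂
  by_cases h0 : H.gp 1 p₁ (a 0) ≤ c₂ + H.δ
  · have g0 := hcon 0 h0
    have g1 := k2 0 1 (by decide) g0
    have g2 := k2 0 2 (by decide) g0
    by_cases h1 : H.gp 1 p₁ (a 1) ≤ c₂ + H.δ
    · linarith [hcon 1 h1]
    · linarith [hcon 2 (k1 1 2 (by decide) (not_le.1 h1))]
  · have g1 := hcon 1 (k1 0 1 (by decide) (not_le.1 h0))
    have g2 := hcon 2 (k1 0 2 (by decide) (not_le.1 h0))
    linarith [k2 1 2 (by decide) g1]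

/-- There are finite families of arbitrarily good probes, transverse to any prescribed pair of
directions at either end. -/
lemma IsAxis.exists_probes (hψ : H.IsAxis ψ c η) (hG : NonVirtuallyCyclic G) :
    ∃ c₀ : ℝ, 0 ≤ c₀ ∧ ∀ C : ℝ, ∃ F : Finset G, (∀ b ∈ F, H.IsProbe C b) ∧
      ∀ p₁ p₂ q₁ q₂ : G, ∃ b ∈ F, H.gp 1 p₁ b ≤ c₀ ∧ H.gp 1 p₂ b ≤ c₀ ∧
        H.gp 1 b⁻¹ q₁ ≤ c₀ ∧ H.gp 1 b⁻¹ q₂ ≤ c₀ := by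
  classical
  have hη := hψ.η_pos
  have hδ := H.δ_nonneg
  obtain ⟨s, c', hs⟩ := hψ.exists_transverse hG
  obtain ⟨t, c₂, ht⟩ := hψ.exists_triple hs
  have hc' := (H.gp_nonneg _ _ _).trans (hs 0 0)
  have hc₂ := (H.gp_nonneg _ _ _).trans (ht 0 1 (by decide) 0 0)
  refine ⟨c₂ + 2 * H.δ, by linarith, fun C => ?_⟩
  set D := ∑ i, H.d 1 (t i) with hD
  have htD : ∀ i, H.d 1 (t i) ≤ D := fun i =>
    Finset.single_le_sum (f := fun i => H.d 1 (t i)) (fun _ _ => H.d_nonneg _ _)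
      (Finset.mem_univ i)
  obtain ⟨N₀, hN₀⟩ := hψ.isProbe hs (C + 2 * D)
  obtain ⟨N₁, hN₁⟩ := exists_nat_gt ((c₂ + 2 * H.δ + c' + H.d 1 s + 3 * D) / η)
  rw [div_lt_iff₀ hη] at hN₁
  set N := max N₀ N₁ with hN
  have hbig : ∀ m : ℕ, N ≤ m → c₂ + 2 * H.δ + c' + H.d 1 s + 3 * D < H.d 1 (ψ ^ m) := by
    intro m hm
    have h1 : (N₁ : ℝ) * η ≤ m * η := by
      have : N₁ ≤ m := (le_max_right N₀ N₁).trans hm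
      gcongr
    linarith [hψ.grow m]
  set β := ψ ^ N * s * ψ ^ (2 * N) with hβ
  have hds := H.d_nonneg 1 s
  have dir : ∀ (i j : Fin 3) (y b p : G),
      c₂ + 2 * H.δ + c' + H.d 1 s + 3 * D < H.d 1 y → H.gp y 1 b ≤ c' + H.d 1 s →
      H.gp 1 p (t i * y) ≤ c₂ + H.δ → H.gp 1 p (t i * b * (t j)⁻¹) ≤ c₂ + 2 * H.δ := by
    intro i j y b p hy hb hp
    have h1 := H.gp_extend (o := 1) (x := p) (y := t i * y) (z := t i * b * (t j)⁻¹)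
      (C := c₂ + H.δ) hp (by
        have h2 := H.gp_add_gp 1 (t i * y) (t i * b * (t j)⁻¹)
        have h3 := H.gp_change_left (t i * y) 1 (t i) (t i * b * (t j)⁻¹)
        have h4 := H.gp_change_right (t i * y) (t i) (t i * b * (t j)⁻¹) (t i * b)
        have h5 := H.gp_mul (t i) y 1 b
        rw [mul_one] at h5
        rw [H.d_mul_self, H.d_one_inv] at h4
        have h6 := H.d_tri (t i) 1 (t i * y)
        rw [H.d_self_mul, H.d_comm (t i) 1] at h6
        rw [gp_comm]
        linarith [htD i, htD j])
    linarith
  refine ⟨Finset.univ.image fun ij : Fin 3 × Fin 3 => t ij.1 * β * (t ij.2)⁻¹, ?_, ?_⟩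
  · intro b hb
    obtain ⟨ij, -, rfl⟩ := Finset.mem_image.1 hb
    exact (hN₀ N (le_max_left _ _)).conj (htD _) (htD _)
  · intro p₁ p₂ q₁ q₂
    obtain ⟨i, hi₁, hi₂⟩ := exists_transverse_index (a := fun i => t i * ψ ^ N)
      (fun i j hij => by simpa using ht i j hij N N) p₁ p₂
    obtain ⟨j, hj₁, hj₂⟩ := exists_transverse_index (a := fun j => t j * (ψ ^ (2 * N))⁻¹)
      (fun i j hij => by
        have := ht i j hij (-(2 * N : ℕ)) (-(2 * N : ℕ))
        rwa [zpow_neg, zpow_natCast] at this) q₁ q₂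
    refine ⟨t i * β * (t j)⁻¹, Finset.mem_image.2 ⟨(i, j), Finset.mem_univ _, rfl⟩, ?_⟩
    have hb1 : H.gp (ψ ^ N) 1 β ≤ c' + H.d 1 s :=
      (gp_pow_mul_le hs N (2 * N)).trans (by linarith)
    have hb2 : H.gp (ψ ^ (2 * N))⁻¹ 1 β⁻¹ ≤ c' + H.d 1 s := by
      have h3 := hs (-N) (2 * N : ℕ)
      rw [← H.gp_mul (ψ ^ (2 * N)), mul_inv_cancel, mul_one]
      have e : ψ ^ (2 * N) * β⁻¹ = s⁻¹ * (ψ ^ N)⁻¹ := by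
        rw [hβ]
        group
      rw [e, ← H.gp_mul s, mul_one, mul_inv_cancel_left, gp_comm]
      rw [zpow_neg, zpow_natCast, zpow_natCast] at h3
      linarith [H.gp_change_base s 1 (ψ ^ N)⁻¹ (s * ψ ^ (2 * N)), H.d_comm s 1]
    have e : (t i * β * (t j)⁻¹)⁻¹ = t j * β⁻¹ * (t i)⁻¹ := by group
    rw [e]
    refine ⟨dir i j _ β p₁ (hbig N le_rfl) hb1 hi₁, dir i j _ β p₂ (hbig N le_rfl) hb1 hi₂, ?_, ?_⟩
    · rw [gp_comm]
      exact dir j i _ β⁻¹ q₁ (by rw [H.d_one_inv]; exact hbig _ (by omega)) hb2 hj₁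
    · rw [gp_comm]
      exact dir j i _ β⁻¹ q₂ (by rw [H.d_one_inv]; exact hbig _ (by omega)) hb2 hj₂

end HypDist

namespace HypDist

variable {G : Type*} [Group G] {H : HypDist G} {C M : ℝ} {a b g : G}

/-- `g` admits a fundamental domain for its axis starting with a translate of `[1, b]`. -/
def IsGood (H : HypDist G) (C : ℝ) (b g : G) : Prop :=
  ∃ y, H.gp y (g⁻¹ * y) (y * b) ≤ C ∧ H.gp (y * b) y (g * y) ≤ C

lemma gp_trans_right (x y z w : G) : H.gp w x z ≤ H.gp w x y + H.gp y x z := by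
  unfold gp
  have := H.d_tri w y z
  linarith [H.d_comm y x, H.d_comm w y]

lemma gp_trans_left (x y z w : G) : H.gp w x z ≤ H.gp w y z + H.gp y x z := by
  have := H.gp_trans_right z y x w
  rwa [H.gp_comm w z x, H.gp_comm w z y, H.gp_comm y z x] at this

lemma le_d_of_good (h₂ : H.gp b 1 a ≤ C) : H.d 1 b - C ≤ H.gp 1 a b := by
  have := H.gp_add_gp 1 b a
  rw [gp_comm]
  linarith

lemma gp_inv_self_le_of_good (h₁ : H.gp 1 a⁻¹ b ≤ C) (h₂ : H.gp b 1 a ≤ C)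
    (hb : 2 * C + H.δ < H.d 1 b) : H.gp 1 a⁻¹ a ≤ C + H.δ :=
  H.gp_extend h₁ (by linarith [le_d_of_good h₂])

lemma le_d_pow_of_good (h₁ : H.gp 1 a⁻¹ b ≤ C) (h₂ : H.gp b 1 a ≤ C)
    (hb : 3 * C + 5 * H.δ + M < H.d 1 b) (hM : 0 ≤ M) (n : ℕ) : n * M ≤ H.d 1 (a ^ n) := by
  have hδ := H.δ_nonneg
  have hC := (H.gp_nonneg _ _ _).trans h₁
  have h3 := le_d_of_good h₂
  have h4 := H.gp_le_left 1 a b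
  refine le_trans ?_ (le_d_pow (gp_inv_self_le_of_good h₁ h₂ (by linarith)) (by linarith) n)
  gcongr
  linarith

lemma finite_of_good (h₁ : H.gp 1 a⁻¹ b ≤ C) (h₂ : H.gp b 1 a ≤ C)
    (hb : 3 * C + 5 * H.δ + M < H.d 1 b) (hM : 0 < M)
    (hfin : {k | H.d 1 k ≤ 1 + 12 * C + 33 * H.δ ∧
      H.d b (k * b) ≤ 1 + 12 * C + 33 * H.δ}.Finite) (K : ℝ) :
    ∃ N : ℕ, {k | H.d 1 k ≤ K ∧ H.d (a ^ N) (k * a ^ N) ≤ K}.Finite := by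
  have hδ := H.δ_nonneg
  have hC := (H.gp_nonneg _ _ _).trans h₁
  have h3 := le_d_of_good h₂
  have h4 := H.gp_le_left 1 a b
  have hstr := gp_pow_pow_le (gp_inv_self_le_of_good h₁ h₂ (by linarith)) (by linarith)
  have hgrow := le_d_pow_of_good h₁ h₂ hb hM.le
  set e := 3 * C + 6 * H.δ with he
  obtain ⟨n, hn⟩ := exists_nat_gt ((K + e + 3 * H.δ + H.d 1 b) / M)
  rw [div_lt_iff₀ hM] at hn
  have hn' := hgrow n
  have hb0 := H.d_nonneg 1 b
  have hmono : ∀ m, n ≤ m → H.gp (a ^ n) 1 (a ^ m) ≤ C + 3 * H.δ := by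
    intro m hm
    obtain ⟨t, rfl⟩ := Nat.exists_eq_add_of_le hm
    have := hstr n t
    rw [← H.gp_mul (a ^ n), mul_one, inv_pow, mul_inv_cancel, ← pow_add] at this
    linarith
  have hgb : H.gp (a ^ n * b) 1 (a ^ (n + (n + 1))) ≤ e := by
    have g1 := hstr n (n + 1)
    have g2 := hstr 1 n
    have g3 := gp_trans_right (H := H) 1 a (a ^ (n + 1)) b
    have g4 := gp_trans_left (H := H) (a⁻¹ ^ n) 1 (a ^ (n + 1)) b
    have g5 := H.gp_mul (a ^ n) b (a⁻¹ ^ n) (a ^ (n + 1))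
    have g6 := H.gp_mul a 1 (a⁻¹ ^ 1) (a ^ n)
    rw [inv_pow, mul_inv_cancel, ← pow_add, ← inv_pow] at g5
    rw [pow_one, mul_inv_cancel, mul_one, ← pow_succ'] at g6
    rw [pow_one] at g2
    linarith
  set N := n + (n + 1) with hN
  have key : ∀ f x, H.d 1 f ≤ K → H.d (a ^ N) (f * a ^ N) ≤ K →
      K + e + 2 * H.δ < H.d 1 x → K + e + 2 * H.δ < H.d x (a ^ N) → H.gp x 1 (a ^ N) ≤ e →
      H.On 1 (a ^ N) (2 * (e + 2 * H.δ)) (H.d 1 (f * x)) (f * x) := by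
    intro f x hf hf' hx hx' hg
    apply On.of_gp_le
    have s1 : H.gp (f * x) (f * a ^ N) 1 ≤ e + H.δ := by
      refine H.gp_extend (y := f) ?_ ?_
      · have := H.gp_mul f x 1 (a ^ N)
        rw [mul_one] at this
        rw [gp_comm]
        linarith
      · have s2 := H.gp_add_gp (f * x) f 1
        have s3 := H.gp_le_right f (f * x) 1
        rw [H.d_mul_self] at s2
        rw [gp_comm]
        linarith [H.d_comm f 1]
    have s4 : H.gp (f * x) 1 (a ^ N) ≤ (e + H.δ) + H.δ := by
      refine H.gp_extend (y := f * a ^ N) (by rwa [gp_comm]) ?_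
      have s2 := H.gp_add_gp (f * x) (f * a ^ N) (a ^ N)
      have s3 := H.gp_le_right (f * a ^ N) (f * x) (a ^ N)
      rw [H.d_mul] at s2
      rw [gp_comm]
      linarith [H.d_comm (f * a ^ N) (a ^ N)]
    linarith
  have hdN : n * M + M ≤ H.d (a ^ n) (a ^ N) := by
    rw [hN, pow_add, H.d_self_mul]
    have := hgrow (n + 1)
    push_cast at this
    linarith
  have htri1 := H.d_tri 1 (a ^ n * b) (a ^ n)
  have htri2 := H.d_tri (a ^ n) (a ^ n * b) (a ^ N)
  rw [H.d_mul_self] at htri1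
  rw [H.d_self_mul] at htri2
  refine ⟨N, ?_⟩
  have on1 : ∀ f, H.d 1 f ≤ K → H.d (a ^ N) (f * a ^ N) ≤ K → _ := fun f hf hf' =>
    key f (a ^ n) hf hf' (by linarith) (by linarith) ((hmono N (by omega)).trans (by linarith))
  have on2 : ∀ f, H.d 1 f ≤ K → H.d (a ^ N) (f * a ^ N) ≤ K → _ := fun f hf hf' =>
    key f (a ^ n * b) hf hf' (by linarith) (by linarith) hgb
  let cls : G → ℤ × ℤ := fun f => (⌊H.d 1 (f * a ^ n)⌋, ⌊H.d 1 (f * (a ^ n * b))⌋)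
  refine Set.Finite.of_finite_fibers cls ?_ ?_
  · refine ((Set.finite_Icc (0 : ℤ) ⌊K + H.d 1 (a ^ n)⌋).prod
      (Set.finite_Icc (0 : ℤ) ⌊K + H.d 1 (a ^ n * b)⌋)).subset ?_
    rintro _ ⟨f, ⟨hf, hf'⟩, rfl⟩
    refine ⟨⟨Int.floor_nonneg.2 (H.d_nonneg _ _), Int.floor_le_floor ?_⟩,
      ⟨Int.floor_nonneg.2 (H.d_nonneg _ _), Int.floor_le_floor ?_⟩⟩
    · linarith [H.d_one_mul f (a ^ n)]
    · linarith [H.d_one_mul f (a ^ n * b)]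
  · rintro _ ⟨f, ⟨hf, hf'⟩, rfl⟩
    refine (hfin.image fun k => f * a ^ n * k * (a ^ n)⁻¹).subset ?_
    rintro f' ⟨⟨hk, hk'⟩, heq⟩
    have heq1 : ⌊H.d 1 (f' * a ^ n)⌋ = ⌊H.d 1 (f * a ^ n)⌋ := congrArg Prod.fst heq
    have heq2 : ⌊H.d 1 (f' * (a ^ n * b))⌋ = ⌊H.d 1 (f * (a ^ n * b))⌋ := congrArg Prod.snd heq
    have r1 := (on1 f hf hf').dist_le (on1 f' hk hk')
    have r2 := (on2 f hf hf').dist_le (on2 f' hk hk')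
    have q1 := (Int.abs_sub_lt_one_of_floor_eq_floor heq1).le
    have q2 := (Int.abs_sub_lt_one_of_floor_eq_floor heq2).le
    rw [abs_sub_comm] at q1 q2
    refine ⟨(f * a ^ n)⁻¹ * f' * a ^ n, ⟨?_, ?_⟩, by group⟩
    · rw [mul_assoc, H.d_inv_mul]
      linarith
    · rw [← H.d_mul (f * a ^ n)]
      have e1 : f * a ^ n * ((f * a ^ n)⁻¹ * f' * a ^ n * b) = f' * (a ^ n * b) := by group
      rw [e1, mul_assoc]
      linarith

lemma IsGood.conj (h : H.IsGood C b g) :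
    ∃ y, H.gp 1 (y⁻¹ * g * y)⁻¹ b ≤ C ∧ H.gp b 1 (y⁻¹ * g * y) ≤ C := by
  obtain ⟨y, h1, h2⟩ := h
  refine ⟨y, ?_, ?_⟩
  · rw [← H.gp_mul y, mul_one]
    have e : y * (y⁻¹ * g * y)⁻¹ = g⁻¹ * y := by group
    rwa [e]
  · rw [← H.gp_mul y, mul_one]
    have e : y * (y⁻¹ * g * y) = g * y := by group
    rwa [e]

lemma conj_pow_eq (y g : G) (n : ℕ) : (y⁻¹ * g * y) ^ n = y⁻¹ * g ^ n * y := by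
  simpa using conj_pow (i := n) (a := y⁻¹) (b := g)

lemma IsGood.exists_tendsto (h : H.IsGood C b g) (hb : 3 * C + 5 * H.δ + M < H.d 1 b)
    (hM : 0 ≤ M) : ∃ τ, M ≤ τ ∧
      Filter.Tendsto (fun n : ℕ => H.d 1 (g ^ n) / n) Filter.atTop (nhds τ) := by
  obtain ⟨y, h1, h2⟩ := h.conj
  have hgrow := le_d_pow_of_good h1 h2 hb hM
  have hsub : Subadditive fun n : ℕ => H.d 1 (g ^ n) := by
    intro m n
    simp only [pow_add]
    exact H.d_one_mul _ _
  have hlim := hsub.tendsto_lim ⟨0, by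
    rintro _ ⟨n, rfl⟩
    exact div_nonneg (H.d_nonneg _ _) (Nat.cast_nonneg n)⟩
  refine ⟨_, ?_, hlim⟩
  have hlow : Filter.Tendsto (fun n : ℕ => M - (2 * H.d 1 y) / n) Filter.atTop (nhds (M - 0)) :=
    tendsto_const_nhds.sub (tendsto_const_div_atTop_nhds_zero_nat _)
  rw [sub_zero] at hlow
  refine le_of_tendsto_of_tendsto hlow hlim ?_
  filter_upwards [Filter.eventually_gt_atTop 0] with n hn
  have hn' : (0 : ℝ) < n := by exact_mod_cast hn
  rw [le_div_iff₀ hn', sub_mul, div_mul_cancel₀ _ hn'.ne']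
  have h3 := hgrow n
  rw [conj_pow_eq] at h3
  have h4 := H.d_one_mul (y⁻¹ * g ^ n) y
  have h5 := H.d_one_mul y⁻¹ (g ^ n)
  rw [H.d_one_inv] at h5
  linarith

lemma IsGood.wpd (h : H.IsGood C b g) (hb : 3 * C + 5 * H.δ + M < H.d 1 b) (hM : 0 < M)
    (hfin : {k | H.d 1 k ≤ 1 + 12 * C + 33 * H.δ ∧
      H.d b (k * b) ≤ 1 + 12 * C + 33 * H.δ}.Finite) (K : ℝ) :
    ∃ N : ℕ, {k | H.d 1 k ≤ K ∧ H.d (g ^ N) (k * g ^ N) ≤ K}.Finite := by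
  obtain ⟨y, h1, h2⟩ := h.conj
  obtain ⟨N, hN⟩ := finite_of_good h1 h2 hb hM hfin (K + 2 * H.d 1 y)
  refine ⟨N, (hN.image fun k => y * k * y⁻¹).subset ?_⟩
  rintro k ⟨hk, hk'⟩
  refine ⟨y⁻¹ * k * y, ⟨?_, ?_⟩, by group⟩
  · have h3 := H.d_one_mul (y⁻¹ * k) y
    have h4 := H.d_one_mul y⁻¹ k
    rw [H.d_one_inv] at h4
    linarith
  · rw [conj_pow_eq, ← H.d_mul y]
    have e1 : y * (y⁻¹ * g ^ N * y) = g ^ N * y := by group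
    have e2 : y * (y⁻¹ * k * y * (y⁻¹ * g ^ N * y)) = k * g ^ N * y := by group
    rw [e1, e2]
    have h3 := H.d_tri (g ^ N * y) (g ^ N) (k * g ^ N * y)
    have h4 := H.d_tri (g ^ N) (k * g ^ N) (k * g ^ N * y)
    rw [H.d_mul_self] at h3
    rw [H.d_self_mul] at h4
    linarith

end HypDist

namespace HypDist

variable {G : Type*} [Group G] {H : HypDist G} {c C R : ℝ} {b g x y z : G}

lemma IsGood.conj_mul (h : H.IsGood C b g) (k : G) : H.IsGood C b (k * g * k⁻¹) := by
  obtain ⟨y, h1, h2⟩ := h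
  refine ⟨k * y, ?_, ?_⟩
  · have e : (k * g * k⁻¹)⁻¹ * (k * y) = k * (g⁻¹ * y) := by group
    rwa [e, mul_assoc k y b, H.gp_mul]
  · have e : k * g * k⁻¹ * (k * y) = k * (g * y) := by group
    rwa [e, mul_assoc k y b, H.gp_mul]

/-- The translate of `[1, b]` by `y` lies ahead of the translate by `x`. -/
def Fwd (H : HypDist G) (c : ℝ) (b x y : G) : Prop :=
  H.gp (x * b) x y ≤ c ∧ H.gp y (x * b) (y * b) ≤ c

lemma Fwd.mul (h : H.Fwd c b x y) (k : G) : H.Fwd c b (k * x) (k * y) := by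
  unfold Fwd
  rw [mul_assoc, mul_assoc, H.gp_mul, H.gp_mul]
  exact h

lemma Fwd.gp_start_le (h : H.Fwd c b x y) (h' : H.Fwd c b y z) (hb : 2 * c + H.δ < H.d 1 b) :
    H.gp y (x * b) z ≤ c + H.δ := by
  refine H.gp_extend h.2 ?_
  have h1 := H.gp_add_gp y (y * b) z
  have h2 := h'.1
  rw [H.d_self_mul] at h1
  rw [gp_comm]
  linarith

lemma Fwd.gp_end_le (h : H.Fwd c b x y) (h' : H.Fwd c b y z) (hb : 2 * c + H.δ < H.d 1 b) :
    H.gp (y * b) (x * b) z ≤ c + H.δ := by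
  rw [gp_comm]
  refine H.gp_extend (y := y) (by rw [gp_comm]; exact h'.1) ?_
  have h1 := H.gp_add_gp y (y * b) (x * b)
  have h2 := h.2
  rw [H.d_self_mul, H.gp_comm y (y * b)] at h1
  rw [gp_comm]
  linarith

lemma Fwd.superadd (h : H.Fwd c b x y) (h' : H.Fwd c b y z) (hb : 2 * c + H.δ < H.d 1 b)
    (hb' : 4 * c + 2 * H.δ ≤ H.d 1 b) :
    H.d (x * b) y + H.d (y * b) z ≤ H.d (x * b) z := by
  have h1 := h.gp_start_le h' hb
  have h2 := h'.1
  unfold gp at h1 h2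
  rw [H.d_mul_self] at h2
  linarith [H.d_comm y (x * b)]

lemma Fwd.on_start (h : H.Fwd c b x y) (h' : H.Fwd c b y z) (hb : 2 * c + H.δ < H.d 1 b)
    (hc : 0 ≤ c) : H.On (x * b) z (4 * c + 2 * H.δ) (H.d (x * b) y) y :=
  (On.of_gp_le (h.gp_start_le h' hb)).mono (by linarith)

lemma Fwd.on_end (h : H.Fwd c b x y) (h' : H.Fwd c b y z) (hb : 2 * c + H.δ < H.d 1 b)
    (hc : 0 ≤ c) :
    H.On (x * b) z (4 * c + 2 * H.δ) (H.d (x * b) y + H.d 1 b) (y * b) := by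
  have h1 := On.of_gp_le (h.gp_end_le h' hb)
  have h2 := h.2
  have h3 := H.gp_nonneg y (x * b) (y * b)
  have hδ := H.δ_nonneg
  unfold gp at h2 h3
  rw [H.d_self_mul, H.d_comm y] at h2 h3
  exact ⟨by linarith [h1.1], by linarith [h1.2]⟩

/-- If cutting out a translate of `b` from `g` does not produce a good element, then the cut
folds the axis of `g` onto itself for long. -/
lemma Fwd.le_fold (h : H.Fwd c b y x) (h' : H.Fwd c b x (g * y))
    (hg : ¬ H.IsGood (c + H.δ) b (x * b⁻¹ * x⁻¹ * g)) {m : ℝ} (hm : m ≤ H.d (y * b) x)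
    (hm' : m ≤ H.d (x * b) (g * y)) :
    m - (c + 2 * H.δ) ≤ H.gp x (x * b⁻¹ * x⁻¹ * (g * y)) (y * b) := by
  have hδ := H.δ_nonneg
  by_contra! hcon
  set f := x * b⁻¹ * x⁻¹ with hf
  refine hg ⟨y, ?_, ?_⟩
  · rw [← H.gp_mul g, gp_comm]
    refine H.gp_extend (y := x * b) ?_ ?_
    · rw [gp_comm, ← mul_assoc g]
      exact h'.2
    · have e : g * ((f * g)⁻¹ * y) = f⁻¹ * y := by group
      rw [e, gp_comm]
      have h1 := H.gp_add_gp (g * y) (x * b) (f⁻¹ * y)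
      have h2 := H.gp_mul f (x * b) (g * y) (f⁻¹ * y)
      have e2 : f * (x * b) = x := by
        rw [hf]
        group
      rw [e2, mul_inv_cancel_left] at h2
      have h3 := H.gp_add_gp x (y * b) y
      have h4 := h.1
      rw [H.d_comm x] at h3
      rw [H.d_comm (g * y)] at h1
      have h5 := H.gp_comm (y * b) x y
      have h6 := H.gp_comm x (y * b) y
      rcases H.gp_tri x (f * (g * y)) y (y * b) with h0 | h0 <;> linarith
  · refine H.gp_extend (y := x) h.1 ?_
    have h1 := H.gp_add_gp (y * b) x (f * (g * y))
    rw [mul_assoc f, gp_comm]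
    have h5 := H.gp_comm x (y * b) (f * (g * y))
    linarith

/-- Three long reflections along `[P, Q]` cannot coexist with a probe that is not reversible. -/
lemma IsProbe.not_three_folds {P Q x₀ x₁ x₂ : G} {e κ a₀ a₁ a₂ : ℝ}
    (hb : H.IsProbe C b) (hC : 12 * e + 11 * H.δ ≤ C)
    (h₀ : H.On P Q e a₀ x₀) (h₁ : H.On P Q e a₁ x₁) (h₂ : H.On P Q e a₂ x₂)
    (h₀' : H.On P Q e (a₀ + H.d 1 b) (x₀ * b)) (h₁' : H.On P Q e (a₁ + H.d 1 b) (x₁ * b))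
    (h₂' : H.On P Q e (a₂ + H.d 1 b) (x₂ * b))
    (hκ₀ : κ ≤ H.gp x₀ (x₀ * b⁻¹ * x₀⁻¹ * Q) P) (hκ₁ : κ ≤ H.gp x₁ (x₁ * b⁻¹ * x₁⁻¹ * Q) P)
    (hκ₂ : κ ≤ H.gp x₂ (x₂ * b⁻¹ * x₂⁻¹ * Q) P)
    (h01 : a₀ + H.d 1 b ≤ a₁) (h12 : a₁ + H.d 1 b ≤ a₂) (hκ : 2 * (a₂ - a₀) ≤ κ)
    (hne : (a₁ - a₀) + H.d 1 b ≤ a₂ - a₁ ∨ (a₂ - a₁) + H.d 1 b ≤ a₁ - a₀) : False := by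
  have hδ := H.δ_nonneg
  have hR := H.d_nonneg 1 b
  have cut : ∀ x : G, x * b⁻¹ * x⁻¹ * (x * b) = x := fun x => by group
  have refl : ∀ (x : G) (a E q : ℝ) (y : G), H.On P Q e a x → H.On P Q e (a + H.d 1 b) (x * b) →
      κ ≤ H.gp x (x * b⁻¹ * x⁻¹ * Q) P → H.On P Q E q y → a + H.d 1 b ≤ q →
      q ≤ a + H.d 1 b + κ →
      H.On P Q (E + 2 * e + 2 * H.δ) (2 * a + H.d 1 b - q) (x * b⁻¹ * x⁻¹ * y) := by
    intro x a E q y hx hx' hk hy hq hq'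
    have := On.reflect (x * b⁻¹ * x⁻¹) hx' (by rwa [cut]) (by rwa [cut]) hy hq hq'
    convert this using 1
    ring
  have refl_inv : ∀ (x : G) (a E q : ℝ) (y : G), H.On P Q e a x →
      H.On P Q e (a + H.d 1 b) (x * b) →
      κ ≤ H.gp x (x * b⁻¹ * x⁻¹ * Q) P → H.On P Q E q y → q ≤ a → a - κ ≤ q →
      H.On P Q (E + 2 * e + 2 * H.δ) (2 * a + H.d 1 b - q) ((x * b⁻¹ * x⁻¹)⁻¹ * y) := by
    intro x a E q y hx hx' hk hy hq hq'
    have := On.reflect_inv (x * b⁻¹ * x⁻¹) hx' (by rwa [cut]) (by rwa [cut]) hy hq hq'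
    convert this using 1
    ring
  set f₀ := x₀ * b⁻¹ * x₀⁻¹
  set f₁ := x₁ * b⁻¹ * x₁⁻¹
  set f₂ := x₂ * b⁻¹ * x₂⁻¹
  have A : ∀ (q : ℝ) (y : G), H.On P Q e q y → a₀ ≤ q → q ≤ a₀ + H.d 1 b →
      H.On P Q (e + 2 * e + 2 * H.δ + 2 * e + 2 * H.δ + 2 * e + 2 * H.δ)
        (2 * a₀ + H.d 1 b - (2 * a₁ + H.d 1 b - (2 * a₂ + H.d 1 b - q)))
        (f₀⁻¹ * (f₁ * (f₂⁻¹ * y))) := by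
    intro q y hy hq hq'
    have s1 := refl_inv x₂ a₂ e q y h₂ h₂' hκ₂ hy (by linarith) (by linarith)
    have s2 := refl x₁ a₁ _ _ _ h₁ h₁' hκ₁ s1 (by linarith) (by linarith)
    exact refl_inv x₀ a₀ _ _ _ h₀ h₀' hκ₀ s2 (by linarith) (by linarith)
  obtain ⟨f, hf⟩ : ∃ f : G, ∀ (q : ℝ) (y : G), H.On P Q e q y → a₀ ≤ q → q ≤ a₀ + H.d 1 b →
      H.On P Q (e + 2 * e + 2 * H.δ + 2 * e + 2 * H.δ)
        (2 * a₂ + H.d 1 b - (2 * a₁ + H.d 1 b - q)) (f * (f₁⁻¹ * y)) := by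
    rcases hne with hne | hne
    · refine ⟨f₂⁻¹, fun q y hy hq hq' => ?_⟩
      have s1 := refl_inv x₁ a₁ e q y h₁ h₁' hκ₁ hy (by linarith) (by linarith)
      exact refl_inv x₂ a₂ _ _ _ h₂ h₂' hκ₂ s1 (by linarith) (by linarith)
    · refine ⟨f₂, fun q y hy hq hq' => ?_⟩
      have s1 := refl_inv x₁ a₁ e q y h₁ h₁' hκ₁ hy (by linarith) (by linarith)
      exact refl x₂ a₂ _ _ _ h₂ h₂' hκ₂ s1 (by linarith) (by linarith)
  have A0 := A _ _ h₀ le_rfl (by linarith)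
  have A1 := A _ _ h₀' (by linarith) le_rfl
  have B0 := hf _ _ h₀ le_rfl (by linarith)
  have B1 := hf _ _ h₀' (by linarith) le_rfl
  have d1 := A0.dist_le B1
  have d2 := A1.dist_le B0
  have z1 : (2 * a₀ + H.d 1 b - (2 * a₁ + H.d 1 b - (2 * a₂ + H.d 1 b - a₀))) -
      (2 * a₂ + H.d 1 b - (2 * a₁ + H.d 1 b - (a₀ + H.d 1 b))) = 0 := by ring
  have z2 : (2 * a₀ + H.d 1 b - (2 * a₁ + H.d 1 b - (2 * a₂ + H.d 1 b - (a₀ + H.d 1 b)))) -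
      (2 * a₂ + H.d 1 b - (2 * a₁ + H.d 1 b - a₀)) = 0 := by ring
  rw [z1, abs_zero] at d1
  rw [z2, abs_zero] at d2
  have hasym := hb.asym ((f * (f₁⁻¹ * x₀))⁻¹ * (f₀⁻¹ * (f₁ * (f₂⁻¹ * x₀)))) (by
    rw [← H.d_mul (f * (f₁⁻¹ * x₀))]
    simp only [mul_assoc, mul_inv_cancel_left] at d1 ⊢
    linarith)
  rw [← H.d_mul (f * (f₁⁻¹ * x₀))] at hasym
  have e1 : f * (f₁⁻¹ * x₀) * ((f * (f₁⁻¹ * x₀))⁻¹ * (f₀⁻¹ * (f₁ * (f₂⁻¹ * x₀))) * b) =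
      f₀⁻¹ * (f₁ * (f₂⁻¹ * (x₀ * b))) := by group
  rw [e1, mul_one] at hasym
  linarith

end HypDist

lemma exists_gapped {α : Type*} (w : α → ℝ) (Z L n : ℕ) (U : Finset α)
    (hZ : ∀ V ⊆ U, (∀ u ∈ V, ∀ v ∈ V, |w u - w v| ≤ 1) → V.card ≤ Z)
    (hU : n * (L * Z) < U.card) :
    ∃ x : ℕ → α, (∀ i ≤ n, x i ∈ U) ∧ ∀ i < n, w (x i) + L ≤ w (x (i + 1)) := by
  classical
  induction n generalizing U with
  | zero =>
    obtain ⟨u, hu⟩ := Finset.card_pos.1 (by simpa using hU)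
    exact ⟨fun _ => u, fun _ _ => hu, fun i hi => absurd hi (Nat.not_lt_zero i)⟩
  | succ n ih =>
    have hne : U.Nonempty := Finset.card_pos.1 (by omega)
    obtain ⟨u₀, hu₀, hmin⟩ := Finset.exists_min_image U w hne
    have hsub : U.filter (fun u => ¬ w u₀ + L ≤ w u) ⊆
        (Finset.range L).biUnion fun i => U.filter fun u => ⌊w u - w u₀⌋₊ = i := by
      intro u hu
      simp only [Finset.mem_filter, not_le] at hu
      simp only [Finset.mem_biUnion, Finset.mem_range, Finset.mem_filter]
      refine ⟨_, ?_, hu.1, rfl⟩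
      rw [Nat.floor_lt (by linarith [hmin u hu.1])]
      linarith
    have hcard : (U.filter (fun u => ¬ w u₀ + L ≤ w u)).card ≤ L * Z := by
      refine (Finset.card_le_card hsub).trans ?_
      have := Finset.card_biUnion_le_card_mul (Finset.range L)
        (fun i => U.filter fun u => ⌊w u - w u₀⌋₊ = i) Z ?_
      · simpa using this
      · intro i _
        refine hZ _ (Finset.filter_subset _ _) fun u hu v hv => ?_
        simp only [Finset.mem_filter] at hu hv
        have h1 := (Nat.floor_eq_iff (by linarith [hmin u hu.1])).1 hu.2
        have h2 := (Nat.floor_eq_iff (by linarith [hmin v hv.1])).1 hv.2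
        rw [abs_le]
        constructor <;> linarith
    have hsplit := Finset.card_filter_add_card_filter_not (s := U) (fun u => w u₀ + L ≤ w u)
    obtain ⟨x, hx, hgap⟩ := ih (U.filter fun u => w u₀ + L ≤ w u)
      (fun V hV => hZ V (hV.trans (Finset.filter_subset _ _))) (by
        rw [Nat.add_mul, one_mul] at hU
        omega)
    refine ⟨fun i => Nat.casesOn i u₀ x, fun i hi => ?_, fun i hi => ?_⟩
    · cases i with
      | zero => exact hu₀
      | succ i => exact Finset.filter_subset _ _ (hx i (by omega))
    · cases i with
      | zero => exact (Finset.mem_filter.1 (hx 0 (by omega))).2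
      | succ i => exact hgap i (by omega)

namespace HypDist

variable {G : Type*} [Group G] {H : HypDist G} {c C R : ℝ} {b g u v x y z : G}

/-- The piece `[u, u * b]` occurs without cancellation in the bi-infinite path spanned by `g`. -/
structure Admissible (H : HypDist G) (c : ℝ) (b g u : G) : Prop where
  start_one : H.gp u 1 (u * b) ≤ c
  end_right : H.gp (u * b) u g ≤ c
  start_left : H.gp u (g⁻¹ * (u * b)) (u * b) ≤ c
  end_next : H.gp (u * b) u (g * u) ≤ c

lemma Admissible.on_start (h : H.Admissible c b g u) (hc : 0 ≤ c)
    (hb : 2 * c + H.δ < H.d 1 b) : H.On 1 g (4 * c + 2 * H.δ) (H.d 1 u) u := by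
  have hδ := H.δ_nonneg
  refine (On.of_gp_le (c := c + H.δ) (H.gp_extend h.start_one ?_)).mono (by linarith)
  have h1 := H.gp_add_gp u (u * b) g
  rw [H.d_self_mul] at h1
  rw [gp_comm]
  linarith [h.end_right]

lemma Admissible.gp_end (h : H.Admissible c b g u)
    (hb : 2 * c + H.δ < H.d 1 b) : H.gp (u * b) 1 g ≤ c + H.δ := by
  rw [gp_comm]
  refine H.gp_extend (y := u) (by rw [gp_comm]; exact h.end_right) ?_
  have h1 := H.gp_add_gp u (u * b) 1
  rw [H.d_self_mul, H.gp_comm u] at h1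
  rw [gp_comm, H.gp_comm _ u]
  linarith [h.start_one, H.gp_comm (u * b) u 1]

lemma Admissible.on_end (h : H.Admissible c b g u) (hc : 0 ≤ c)
    (hb : 2 * c + H.δ < H.d 1 b) : H.On 1 g (4 * c + 2 * H.δ) (H.d 1 u + H.d 1 b) (u * b) := by
  have hδ := H.δ_nonneg
  have h1 := On.of_gp_le (h.gp_end hb)
  have h2 := h.start_one
  have h3 := H.gp_nonneg u 1 (u * b)
  unfold gp at h2 h3
  rw [H.d_self_mul, H.d_comm u] at h2 h3
  exact ⟨by linarith [h1.1], by linarith [h1.2]⟩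

lemma Admissible.length_le (h : H.Admissible c b g u)
    (hb : 2 * c + H.δ < H.d 1 b) : H.d 1 u + H.d 1 b ≤ H.d 1 g + (4 * c + 2 * H.δ) := by
  have h1 := h.gp_end hb
  have h2 := h.start_one
  have h3 := H.d_nonneg (u * b) g
  unfold gp at h1 h2
  rw [H.d_self_mul, H.d_comm u] at h2
  rw [H.d_comm _ 1] at h1
  linarith

lemma Admissible.fwd (h : H.Admissible c b g u) (h' : H.Admissible c b g v) (hc : 0 ≤ c)
    (hb : 2 * c + H.δ < H.d 1 b) (huv : H.d 1 u + H.d 1 b ≤ H.d 1 v) :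
    H.Fwd (14 * c + 9 * H.δ) b u v := by
  have hδ := H.δ_nonneg
  have hR := H.d_nonneg 1 b
  constructor
  · have := (h.on_start hc hb).gp_le (h.on_end hc hb) (h'.on_start hc hb) (by linarith) huv
    linarith
  · have := (h.on_end hc hb).gp_le (h'.on_start hc hb) (h'.on_end hc hb) huv (by linarith)
    linarith

lemma Admissible.fwd_mul (h : H.Admissible c b g u) (h' : H.Admissible c b g v) (hc : 0 ≤ c)
    (hb : 2 * c + H.δ < H.d 1 b) (huv : H.d 1 u ≤ H.d 1 v) :
    H.Fwd (14 * c + 9 * H.δ) b v (g * u) := by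
  have hδ := H.δ_nonneg
  have hR := H.d_nonneg 1 b
  have hC : 0 ≤ 3 * (4 * c + 2 * H.δ) + H.δ := by linarith
  constructor
  · have h1 : H.On 1 g (4 * c + 2 * H.δ) 0 1 := by
      constructor <;> linarith [H.d_self 1]
    have h2 := h1.gp_le (h.on_start hc hb) (h'.on_start hc hb) (H.d_nonneg 1 u) huv
    rw [← H.gp_mul g, mul_one] at h2
    have := gp_convex hC hc h'.end_right h'.end_next h2
    linarith
  · have h1 : H.On 1 g (4 * c + 2 * H.δ) (H.d 1 g + (4 * c + 2 * H.δ)) g := by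
      constructor <;> linarith [H.d_self g]
    have h2 := (h.on_end hc hb).gp_le (h'.on_end hc hb) h1 (by linarith) (h'.length_le hb)
    rw [← H.gp_mul g⁻¹, inv_mul_cancel] at h2
    have h3 := h.start_left
    have h4 := h.start_one
    rw [gp_comm] at h3 h4
    have := gp_convex hC hc h3 h4 h2
    rw [← H.gp_mul g⁻¹, inv_mul_cancel_left, gp_comm, ← mul_assoc g⁻¹ (g * u),
      inv_mul_cancel_left]
    linarith

/-- A periodic sequence of forward translates of a probe, cutting each of which fails to produce a
good element, cannot exist. -/
lemma IsProbe.not_periodic {x : ℕ → G} (hb : H.IsProbe C b) (hc : 0 ≤ c)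
    (hR : 4 * c + 3 * H.δ + 1 ≤ H.d 1 b) (hC : 48 * c + 35 * H.δ ≤ C)
    (hx : ∀ i, g * x i = x (i + 27))
    (hF : ∀ i j, i < j → j ≤ i + 27 → H.Fwd c b (x i) (x j))
    (hL : ∀ i, 9 * H.d 1 b ≤ H.d (x i * b) (x (i + 1)))
    (hg : ∀ i, ¬ H.IsGood (c + H.δ) b (x i * b⁻¹ * (x i)⁻¹ * g)) : False := by
  have hδ := H.δ_nonneg
  have hb1 : 2 * c + H.δ < H.d 1 b := by linarith
  have hb2 : 4 * c + 2 * H.δ ≤ H.d 1 b := by linarith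
  set R := H.d 1 b with hRdef
  set L : ℕ → ℕ → ℝ := fun i j => H.d (x i * b) (x j) with hLdef
  have hadd : ∀ i j k, i < j → j < k → k ≤ i + 27 → L i j + L j k ≤ L i k := fun i j k h1 h2 h3 =>
    (hF i j h1 (by omega)).superadd (hF j k h2 (by omega)) hb1 hb2
  have htri : ∀ i j k, L i k ≤ L i j + R + L j k := fun i j k => by
    have h1 := H.d_tri (x i * b) (x j) (x k)
    have h2 := H.d_tri (x j) (x j * b) (x k)
    rw [H.d_self_mul] at h2
    simp only [hLdef]
    linarith
  have hnn : ∀ i j, 0 ≤ L i j := fun i j => H.d_nonneg _ _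
  have hper : Function.Periodic (fun i => L i (i + 3)) 27 := fun i => by
    simp only [hLdef]
    rw [← hx, show i + 27 + 3 = i + 3 + 27 by ring, ← hx, mul_assoc, H.d_mul]
  obtain ⟨m, -, hm⟩ := Finset.exists_min_image (Finset.range 27) (fun i => L i (i + 3))
    ⟨0, by simp⟩
  have hmin : ∀ i, L m (m + 3) ≤ L i (i + 3) := fun i => by
    rw [← hper.map_mod_nat i]
    exact hm _ (Finset.mem_range.2 (Nat.mod_lt _ (by norm_num)))
  set s := L m (m + 3) with hs
  set r := m + 15 with hr
  have hs0 : L (r + 12) (r + 15) = s := by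
    have := hper m
    simp only at this
    rw [hs, ← this]
  have h4 : ∀ i, 4 * s ≤ L i (i + 12) := fun i => by
    have h1 := hadd i (i + 3) (i + 6) (by omega) (by omega) (by omega)
    have h2 := hadd i (i + 6) (i + 9) (by omega) (by omega) (by omega)
    have h3 := hadd i (i + 9) (i + 12) (by omega) (by omega) (by omega)
    have := hmin i
    have := hmin (i + 3)
    have := hmin (i + 6)
    have := hmin (i + 9)
    linarith
  have hleft : ∀ j, r + 12 ≤ j → j ≤ r + 15 → 4 * s ≤ L r j := fun j h1 h2 => by
    rcases h1.eq_or_lt with h1 | h1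
    · exact h1 ▸ h4 r
    · have := hadd r (r + 12) j (by omega) h1 (by omega)
      linarith [h4 r, hnn (r + 12) j]
  have hright : ∀ j, r + 12 ≤ j → j ≤ r + 15 → 4 * s ≤ L j (r + 27) := fun j h1 h2 => by
    have h := h4 (r + 15)
    rcases h2.eq_or_lt with h2 | h2
    · exact h2 ▸ h
    · have := hadd j (r + 15) (r + 27) h2 (by omega) (by omega)
      rw [show r + 15 + 12 = r + 27 by ring] at h
      linarith [hnn j (r + 15)]
  have on1 : ∀ j, r + 12 ≤ j → j ≤ r + 15 →
      H.On (x r * b) (g * x r) (4 * c + 2 * H.δ) (L r j) (x j) := fun j h1 h2 => by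
    rw [hx]
    exact (hF r j (by omega) (by omega)).on_start (hF j (r + 27) (by omega) (by omega)) hb1 hc
  have on2 : ∀ j, r + 12 ≤ j → j ≤ r + 15 →
      H.On (x r * b) (g * x r) (4 * c + 2 * H.δ) (L r j + R) (x j * b) := fun j h1 h2 => by
    rw [hx]
    exact (hF r j (by omega) (by omega)).on_end (hF j (r + 27) (by omega) (by omega)) hb1 hc
  have fold : ∀ j, r + 12 ≤ j → j ≤ r + 15 →
      4 * s - (c + 2 * H.δ) ≤ H.gp (x j) (x j * b⁻¹ * (x j)⁻¹ * (g * x r)) (x r * b) :=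
    fun j h1 h2 => by
      have h3 := hF j (r + 27) (by omega) (by omega)
      have h5 := hright j h1 h2
      simp only [hLdef] at h5
      rw [← hx] at h3 h5
      exact (hF r j (by omega) (by omega)).le_fold h3 (hg j) (hleft j h1 h2) h5
  have step : ∀ j, r < j → j + 1 ≤ r + 27 → L r j + 9 * R ≤ L r (j + 1) := fun j h1 h2 => by
    have := hadd r j (j + 1) h1 (by omega) h2
    have := hL j
    simp only [hLdef] at *
    linarith
  have g1 := step (r + 12) (by omega) (by omega)
  have g2 := step (r + 13) (by omega) (by omega)
  have g3 := step (r + 14) (by omega) (by omega)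
  have g4 := htri r (r + 12) (r + 15)
  have g5 : 27 * R ≤ s := by
    have h1 := hadd (r + 12) (r + 13) (r + 14) (by omega) (by omega) (by omega)
    have h2 := hadd (r + 12) (r + 14) (r + 15) (by omega) (by omega) (by omega)
    have := hL (r + 12)
    have := hL (r + 13)
    have := hL (r + 14)
    simp only [hLdef] at *
    linarith
  rw [hs0] at g4
  have hC' : 12 * (4 * c + 2 * H.δ) + 11 * H.δ ≤ C := by linarith
  by_cases hcase : (L r (r + 13) - L r (r + 12)) + R ≤ L r (r + 14) - L r (r + 13) ∨
      (L r (r + 14) - L r (r + 13)) + R ≤ L r (r + 13) - L r (r + 12)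
  · exact hb.not_three_folds hC' (on1 (r + 12) (by omega) (by omega))
      (on1 (r + 13) (by omega) (by omega)) (on1 (r + 14) (by omega) (by omega))
      (on2 (r + 12) (by omega) (by omega)) (on2 (r + 13) (by omega) (by omega))
      (on2 (r + 14) (by omega) (by omega)) (fold (r + 12) (by omega) (by omega))
      (fold (r + 13) (by omega) (by omega)) (fold (r + 14) (by omega) (by omega))
      (by linarith) (by linarith) (by linarith) hcase
  · push Not at hcase
    exact hb.not_three_folds hC' (on1 (r + 12) (by omega) (by omega))
      (on1 (r + 13) (by omega) (by omega)) (on1 (r + 15) (by omega) (by omega))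
      (on2 (r + 12) (by omega) (by omega)) (on2 (r + 13) (by omega) (by omega))
      (on2 (r + 15) (by omega) (by omega)) (fold (r + 12) (by omega) (by omega))
      (fold (r + 13) (by omega) (by omega)) (fold (r + 15) (by omega) (by omega))
      (by linarith) (by linarith) (by linarith) (Or.inl (by linarith [hcase.2]))

/-- There are boundedly many places where a probe can be cut out of `g` without producing a good
element. -/
lemma IsProbe.exists_card_le (hb : H.IsProbe C b) (hc : 0 ≤ c)
    (hR : 100 * (c + H.δ) + 1 ≤ H.d 1 b) (hC : 700 * (c + H.δ) + 1 ≤ C) :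
    ∃ N : ℕ, ∀ (g : G) (U : Finset G), (∀ u ∈ U, H.Admissible c b g u ∧
      ¬ H.IsGood (14 * c + 10 * H.δ) b (u * b⁻¹ * u⁻¹ * g)) → U.card ≤ N := by
  classical
  have hδ := H.δ_nonneg
  have hb0 : 2 * c + H.δ < H.d 1 b := by linarith
  set R := H.d 1 b with hRdef
  refine ⟨27 * (⌈10 * R⌉₊ * hb.fin.toFinset.card), fun g U hU => ?_⟩
  by_contra! hcon
  obtain ⟨u, hu, hgap⟩ := exists_gapped (fun u => H.d 1 u) _ _ _ U (fun V hV hdiam => by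
    rcases V.eq_empty_or_nonempty with rfl | ⟨v, hv⟩
    · simp
    · refine Finset.card_le_card_of_injOn (fun w => v⁻¹ * w) (fun w hw => ?_)
        (fun w _ w' _ h => mul_left_cancel h)
      have h1 := (hU v (hV hv)).1
      have h2 := (hU w (hV hw)).1
      have h3 := (h1.on_start hc hb0).dist_le (h2.on_start hc hb0)
      have h4 := (h1.on_end hc hb0).dist_le (h2.on_end hc hb0)
      have h5 := hdiam v hv w hw
      rw [add_sub_add_right_eq_sub] at h4
      simp only [Set.Finite.coe_toFinset, Set.mem_ofPred_eq]
      rw [H.d_inv_mul, ← H.d_mul v b, ← mul_assoc v, mul_inv_cancel_left]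
      constructor <;> linarith) hcon
  have hR10 : 10 * R ≤ (⌈10 * R⌉₊ : ℝ) := Nat.le_ceil _
  have hR0 : 0 ≤ R := H.d_nonneg 1 b
  have hA : ∀ i ≤ 27, H.Admissible c b g (u i) := fun i hi => (hU _ (hu i hi)).1
  have hmono : ∀ i j, i < j → j ≤ 27 → H.d 1 (u i) + 10 * R ≤ H.d 1 (u j) := by
    intro i j hij hj
    induction j, hij using Nat.le_induction with
    | base =>
      have := hgap i (by omega)
      simp only [Nat.succ_eq_add_one]
      linarith
    | succ j hij ih =>
      have := hgap j (by omega)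
      have := ih (by omega)
      linarith
  have hF1 : ∀ i j, i < j → j ≤ 27 → H.Fwd (14 * c + 9 * H.δ) b (u i) (u j) := fun i j hij hj =>
    (hA i (by omega)).fwd (hA j hj) hc hb0 (by linarith [hmono i j hij hj])
  have hF2 : ∀ i j, i ≤ j → j ≤ 27 → H.Fwd (14 * c + 9 * H.δ) b (u j) (g * u i) :=
    fun i j hij hj => (hA i (by omega)).fwd_mul (hA j hj) hc hb0 (by
      rcases hij.eq_or_lt with rfl | h
      · exact le_rfl
      · linarith [hmono i j h hj])
  have hlen : ∀ i, i < 27 → 9 * R ≤ H.d (u i * b) (u (i + 1)) := fun i hi => by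
    have h1 := hmono i (i + 1) (by omega) (by omega)
    have h2 := H.d_tri 1 (u i) (u (i + 1))
    have h3 := H.d_tri (u i) (u i * b) (u (i + 1))
    rw [H.d_self_mul] at h3
    linarith
  have key : ∀ q i, i < 27 → g ^ ((27 * q + i) / 27) * u ((27 * q + i) % 27) = g ^ q * u i := by
    intro q i hi
    rw [show (27 * q + i) / 27 = q by omega, show (27 * q + i) % 27 = i by omega]
  refine hb.not_periodic (x := fun n => g ^ (n / 27) * u (n % 27)) (g := g)
    (c := 14 * c + 9 * H.δ) (by linarith) (by linarith) (by linarith) ?_ ?_ ?_ ?_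
  · intro i
    rw [show (i + 27) / 27 = i / 27 + 1 by omega, show (i + 27) % 27 = i % 27 by omega, pow_succ',
      mul_assoc]
  · intro i j hij hj
    by_cases h : j / 27 = i / 27
    · rw [h]
      exact (hF1 _ _ (by omega) (by omega)).mul _
    · rw [show j / 27 = i / 27 + 1 by omega, pow_succ, mul_assoc]
      exact (hF2 _ _ (by omega) (by omega)).mul _
  · intro i
    by_cases h : i % 27 = 26
    · rw [show (i + 1) / 27 = i / 27 + 1 by omega, show (i + 1) % 27 = 0 by omega, pow_succ,
        mul_assoc, mul_assoc, H.d_mul, h]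
      have h1 := (hF1 26 27 (by omega) (by omega)).superadd (hF2 0 27 (by omega) (by omega))
        (by linarith) (by linarith)
      have := hlen 26 (by omega)
      have := H.d_nonneg (u 27 * b) (g * u 0)
      linarith
    · rw [show (i + 1) / 27 = i / 27 by omega, show (i + 1) % 27 = i % 27 + 1 by omega,
        mul_assoc, H.d_mul]
      exact hlen _ (by omega)
  · intro i hgood
    refine (hU _ (hu (i % 27) (by omega))).2 ?_
    have := hgood.conj_mul (g ^ (i / 27))⁻¹
    convert this using 1
    · ring
    · group

end HypDist

section WordLength

variable {G : Type*} [Group G] {S : Finset G}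

lemma wordLength_prod_le {l : List G} (hl : ∀ x ∈ l, x ∈ S ∨ x⁻¹ ∈ S) :
    wordLength S l.prod ≤ l.length :=
  Nat.sInf_le ⟨l, rfl, hl, rfl⟩

lemma exists_word (hS : Subgroup.closure (S : Set G) = ⊤) (g : G) :
    ∃ l : List G, l.length = wordLength S g ∧ (∀ x ∈ l, x ∈ S ∨ x⁻¹ ∈ S) ∧ l.prod = g := by
  refine Nat.sInf_mem (s := {n | ∃ l : List G, l.length = n ∧ (∀ x ∈ l, x ∈ S ∨ x⁻¹ ∈ S) ∧
    l.prod = g}) ?_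
  have hg : g ∈ Subgroup.closure (S : Set G) := hS ▸ Subgroup.mem_top g
  rw [← Subgroup.mem_toSubmonoid, Subgroup.closure_toSubmonoid] at hg
  obtain ⟨l, hl, hg⟩ := Submonoid.exists_list_of_mem_closure hg
  exact ⟨l.length, l, rfl, fun x hx => by simpa using hl x hx, hg⟩

lemma wordLength_mul_le (hS : Subgroup.closure (S : Set G) = ⊤) (g h : G) :
    wordLength S (g * h) ≤ wordLength S g + wordLength S h := by
  obtain ⟨l, hl, hlS, rfl⟩ := exists_word hS g
  obtain ⟨m, hm, hmS, rfl⟩ := exists_word hS h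
  rw [← hl, ← hm, ← List.prod_append, ← List.length_append]
  exact wordLength_prod_le fun x hx => (List.mem_append.1 hx).elim (hlS x) (hmS x)

lemma exists_split (hS : Subgroup.closure (S : Set G) = ⊤) (g : G) {i : ℕ}
    (hi : i ≤ wordLength S g) :
    ∃ u v, u * v = g ∧ wordLength S u = i ∧ wordLength S v + i = wordLength S g := by
  obtain ⟨l, hl, hlS, hg⟩ := exists_word hS g
  have h1 := wordLength_prod_le (S := S) (l := l.take i) fun x hx => hlS x (List.mem_of_mem_take hx)
  have h2 := wordLength_prod_le (S := S) (l := l.drop i) fun x hx => hlS x (List.mem_of_mem_drop hx)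
  have h3 : (l.take i).prod * (l.drop i).prod = g := by
    rw [List.prod_take_mul_prod_drop, hg]
  have h4 := wordLength_mul_le hS (l.take i).prod (l.drop i).prod
  rw [h3] at h4
  rw [List.length_take] at h1
  rw [List.length_drop] at h2
  exact ⟨_, _, h3, by omega, by omega⟩

lemma mem_ball_natCast {n : ℕ} {g : G} : g ∈ ball S (n : ℝ) ↔ wordLength S g ≤ n := by
  simp [ball]

lemma finite_ball (hS : Subgroup.closure (S : Set G) = ⊤) (n : ℕ) : (ball S (n : ℝ)).Finite := by
  classical
  have hT : (↑(S ∪ S.image (·⁻¹)) : Set G).Finite := Finset.finite_toSet _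
  have key : ∀ n : ℕ, {g | ∃ l : List G, l.length ≤ n ∧ (∀ x ∈ l, x ∈ S ∨ x⁻¹ ∈ S) ∧
      l.prod = g}.Finite := fun n => by
    induction n with
    | zero =>
      refine (Set.finite_singleton 1).subset ?_
      rintro g ⟨l, hl, -, rfl⟩
      simp [List.length_eq_zero_iff.1 (Nat.le_zero.1 hl)]
    | succ n ih =>
      refine ((Set.finite_singleton 1).union (hT.image2 (· * ·) ih)).subset ?_
      rintro g ⟨l, hl, hlS, rfl⟩
      cases l with
      | nil => simp
      | cons a l =>
        refine Or.inr ⟨a, ?_, l.prod, ⟨l, by simpa using hl, fun x hx => hlS x (by simp [hx]), rfl⟩,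
          by simp⟩
        rcases hlS a (by simp) with h | h
        · simp [h]
        · simp [h]
  refine (key n).subset fun g hg => ?_
  obtain ⟨l, hl, hlS, hlg⟩ := exists_word hS g
  exact ⟨l, hl ▸ mem_ball_natCast.1 hg, hlS, hlg⟩

lemma ncard_ball_add_le (hS : Subgroup.closure (S : Set G) = ⊤) (n m : ℕ) :
    (ball S ((n + m : ℕ) : ℝ)).ncard ≤ (ball S (n : ℝ)).ncard * (ball S (m : ℝ)).ncard := by
  have hfin := (finite_ball hS n).prod (finite_ball hS m)
  rw [← Set.ncard_prod]
  refine (Set.ncard_le_ncard (t := (fun p : G × G => p.1 * p.2) '' (ball S n ×ˢ ball S m)) ?_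
    (hfin.image _)).trans (Set.ncard_image_le hfin)
  intro g hg
  rw [mem_ball_natCast] at hg
  obtain ⟨u, v, h1, h2, h3⟩ := exists_split hS g (i := min n (wordLength S g)) (by omega)
  refine ⟨(u, v), ⟨?_, ?_⟩, h1⟩ <;> rw [mem_ball_natCast] <;> dsimp only <;> omega

lemma tendsto_ncard_ball (hS : Subgroup.closure (S : Set G) = ⊤) [Infinite G] :
    Filter.Tendsto (fun n : ℕ => (ball S (n : ℝ)).ncard) Filter.atTop Filter.atTop := by
  refine Filter.tendsto_atTop_atTop.2 fun k => ?_
  obtain ⟨F, hF⟩ := Infinite.exists_subset_card_eq G k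
  refine ⟨F.sup (wordLength S), fun n hn => ?_⟩
  rw [← hF, ← Set.ncard_coe_finset]
  refine Set.ncard_le_ncard (fun g hg => ?_) (finite_ball hS n)
  exact mem_ball_natCast.2 ((Finset.le_sup (f := wordLength S) hg).trans hn)

/-- If at every place in an element of `A` one can insert an element of `F`, in such a way that the
place can be recovered up to `N` choices, then `A` has few long elements. -/
lemma sum_wordLength_le (hS : Subgroup.closure (S : Set G) = ⊤) {F : Finset G} {n m N : ℕ}
    (hF : ∀ b ∈ F, wordLength S b ≤ m) {T : G → G → G → Prop} {A : Finset G}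
    (hT : ∀ b ∈ F, ∀ (g : G) (U : Finset G), (∀ u ∈ U, T b g u) → U.card ≤ N)
    (hA : ∀ g ∈ A, wordLength S g ≤ n ∧ ∀ u v, u * v = g → ∃ b ∈ F, T b (u * b * v) u) :
    ∑ g ∈ A, (wordLength S g + 1) ≤ N * (F.card * (ball S ((n + m : ℕ) : ℝ)).ncard) := by
  classical
  have h1 : ∀ p : G × ℕ, ∃ q : G × G × G, p.1 ∈ A → p.2 ≤ wordLength S p.1 →
      q.1 ∈ F ∧ wordLength S q.2.1 ≤ n + m ∧ T q.1 q.2.1 q.2.2 ∧ wordLength S q.2.2 = p.2 ∧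
        q.2.2 * q.1⁻¹ * q.2.2⁻¹ * q.2.1 = p.1 := by
    rintro ⟨g, i⟩
    by_cases hg : g ∈ A ∧ i ≤ wordLength S g
    · obtain ⟨u, v, huv, hu, hv⟩ := exists_split hS g hg.2
      obtain ⟨b, hb, hbT⟩ := (hA g hg.1).2 u v huv
      refine ⟨(b, u * b * v, u), fun _ _ => ⟨hb, ?_, hbT, hu, ?_⟩⟩
      · have := wordLength_mul_le hS (u * b) v
        have := wordLength_mul_le hS u b
        have := (hA g hg.1).1
        have := hF b hb
        dsimp only
        omega
      · dsimp only
        rw [← huv]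
        group
    · exact ⟨1, fun h h' => absurd ⟨h, h'⟩ hg⟩
  choose q hq using h1
  set I : Finset (Σ _ : G, ℕ) := A.sigma fun g => Finset.range (wordLength S g + 1) with hI
  have hmem : ∀ p ∈ I, p.1 ∈ A ∧ p.2 ≤ wordLength S p.1 := fun p hp => by
    simpa [hI, Nat.lt_succ_iff] using hp
  have hcard : I.card = ∑ g ∈ A, (wordLength S g + 1) := by
    simp [hI, Finset.card_sigma]
  rw [← hcard]
  let f : (Σ _ : G, ℕ) → G × G := fun p => ((q (p.1, p.2)).1, (q (p.1, p.2)).2.1)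
  refine (Finset.card_le_mul_card_image (f := f) I N ?_).trans (Nat.mul_le_mul_left _ ?_)
  · intro a ha
    obtain ⟨p₀, hp₀, rfl⟩ := Finset.mem_image.1 ha
    have hinj : Set.InjOn (fun p : Σ _ : G, ℕ => (q (p.1, p.2)).2.2)
        (I.filter fun x => f x = f p₀) := by
      rintro ⟨g, i⟩ hp ⟨g', i'⟩ hp' h
      simp only [Finset.coe_filter, Set.mem_ofPred_eq] at hp hp' h
      obtain ⟨e1, e2⟩ := hmem _ hp.1
      obtain ⟨e3, e4⟩ := hmem _ hp'.1
      obtain ⟨-, -, -, k1, k2⟩ := hq (g, i) e1 e2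
      obtain ⟨-, -, -, k3, k4⟩ := hq (g', i') e3 e4
      have h0 := Prod.mk.inj (hp.2.trans hp'.2.symm)
      simp only at h0
      rw [h] at k1 k2
      rw [h0.1, h0.2] at k2
      have hi : i = i' := k1.symm.trans k3
      have hg : g = g' := k2.symm.trans k4
      rw [hi, hg]
    rw [← Finset.card_image_of_injOn hinj]
    obtain ⟨e1, e2⟩ := hmem _ hp₀
    refine hT (f p₀).1 (hq (p₀.1, p₀.2) e1 e2).1 (f p₀).2 _ fun u hu => ?_
    obtain ⟨p, hp, rfl⟩ := Finset.mem_image.1 hu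
    obtain ⟨hp, hpf⟩ := Finset.mem_filter.1 hp
    obtain ⟨e3, e4⟩ := hmem _ hp
    rw [← hpf]
    exact (hq (p.1, p.2) e3 e4).2.2.1
  · have hsub : I.image f ⊆ F ×ˢ (finite_ball hS (n + m)).toFinset := by
      intro a ha
      obtain ⟨p, hp, rfl⟩ := Finset.mem_image.1 ha
      obtain ⟨e3, e4⟩ := hmem _ hp
      have := hq (p.1, p.2) e3 e4
      rw [Finset.mem_product, Set.Finite.mem_toFinset, mem_ball_natCast]
      exact ⟨this.1, this.2.1⟩
    refine (Finset.card_le_card hsub).trans ?_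
    rw [Finset.card_product, Set.ncard_eq_toFinset_card _ (finite_ball hS (n + m))]

/-- A set whose elements have bounded average insertion cost is generic. -/
lemma tendsto_ncard_ball_inter_div (hS : Subgroup.closure (S : Set G) = ⊤) [Infinite G]
    {F : Finset G} {N : ℕ} {T : G → G → G → Prop} (P : G → Prop)
    (hT : ∀ b ∈ F, ∀ (g : G) (U : Finset G), (∀ u ∈ U, T b g u) → U.card ≤ N)
    (hP : ∀ g, ¬ P g → ∀ u v, u * v = g → ∃ b ∈ F, T b (u * b * v) u) :
    Filter.Tendsto (fun n : ℕ => ({g ∈ ball S (n : ℝ) | P g}.ncard : ℝ) /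
      ((ball S (n : ℝ)).ncard : ℝ)) Filter.atTop (nhds 1) := by
  classical
  set m := F.sup (wordLength S) with hm
  set D : ℕ := N * (F.card * (ball S (m : ℝ)).ncard) with hD
  set β : ℕ → ℕ := fun n => (ball S (n : ℝ)).ncard with hβ
  have hβpos : ∀ n, 0 < β n := fun n => by
    rw [hβ, Set.ncard_pos (finite_ball hS n)]
    refine ⟨1, mem_ball_natCast.2 ?_⟩
    have := wordLength_prod_le (S := S) (l := []) (by simp)
    simp only [List.prod_nil, List.length_nil] at this
    omega
  have hbad : ∀ n r : ℕ, r * ({g ∈ ball S (n : ℝ) | ¬ P g}).ncard ≤ r * β r + D * β n := by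
    intro n r
    have hfin : ({g ∈ ball S (n : ℝ) | ¬ P g}).Finite := (finite_ball hS n).subset fun g hg => hg.1
    set A := hfin.toFinset with hA
    have hAmem : ∀ g ∈ A, wordLength S g ≤ n ∧ ¬ P g := fun g hg => by
      obtain ⟨h1, h2⟩ := hfin.mem_toFinset.1 hg
      exact ⟨mem_ball_natCast.1 h1, h2⟩
    have h1 := sum_wordLength_le hS (F := F) (n := n) (m := m) (N := N)
      (fun b hb => Finset.le_sup (f := wordLength S) hb) (A := A) hT
      fun g hg => ⟨(hAmem g hg).1, hP g (hAmem g hg).2⟩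
    have h2 := ncard_ball_add_le hS n m
    have h3 : N * (F.card * (ball S ((n + m : ℕ) : ℝ)).ncard) ≤ D * β n := by
      calc _ ≤ N * (F.card * ((ball S (n : ℝ)).ncard * (ball S (m : ℝ)).ncard)) := by gcongr
        _ = _ := by simp only [hD, hβ]; ring
    rw [Set.ncard_eq_toFinset_card _ hfin, ← hA,
      ← Finset.card_filter_add_card_filter_not (s := A) (fun g => wordLength S g ≤ r), mul_add]
    refine add_le_add (Nat.mul_le_mul_left _ ?_) (le_trans ?_ (h1.trans h3))
    · rw [hβ]
      simp only
      rw [Set.ncard_eq_toFinset_card _ (finite_ball hS r)]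
      refine Finset.card_le_card fun g hg => ?_
      rw [Set.Finite.mem_toFinset, mem_ball_natCast]
      exact (Finset.mem_filter.1 hg).2
    · rw [mul_comm, ← smul_eq_mul]
      refine (Finset.card_nsmul_le_sum _ (fun g => wordLength S g + 1) r fun g hg => ?_).trans
        (Finset.sum_le_sum_of_subset (Finset.filter_subset _ _))
      have := (Finset.mem_filter.1 hg).2
      omega
  have hsplit : ∀ n : ℕ, ({g ∈ ball S (n : ℝ) | P g}.ncard : ℝ) / (β n : ℝ) =
      1 - ({g ∈ ball S (n : ℝ) | ¬ P g}).ncard / (β n : ℝ) := fun n => by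
    have h0 : (β n : ℝ) ≠ 0 := by exact_mod_cast (hβpos n).ne'
    rw [eq_sub_iff_add_eq, ← add_div, div_eq_one_iff_eq h0, ← Nat.cast_add,
      ← Set.ncard_union_eq (Set.disjoint_left.2 fun g h1 h2 => h2.2 h1.2)
        ((finite_ball hS n).subset fun g hg => hg.1) ((finite_ball hS n).subset fun g hg => hg.1)]
    congr 2
    ext g
    simp only [Set.mem_union, Set.mem_sep_iff]
    tauto
  suffices h : Filter.Tendsto (fun n : ℕ => (({g ∈ ball S (n : ℝ) | ¬ P g}).ncard : ℝ) / (β n : ℝ))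
      Filter.atTop (nhds 0) by
    have := h.const_sub 1
    rw [sub_zero] at this
    exact this.congr fun n => (hsplit n).symm
  rw [Metric.tendsto_atTop]
  intro ε hε
  obtain ⟨r, hr⟩ := exists_nat_gt (2 * D / ε)
  have hr0 : (0 : ℝ) < r := lt_of_le_of_lt (by positivity) hr
  rw [div_lt_iff₀ hε] at hr
  have htend : Filter.Tendsto (fun n => (β n : ℝ)) Filter.atTop Filter.atTop :=
    tendsto_natCast_atTop_atTop.comp (tendsto_ncard_ball hS)
  obtain ⟨n₀, hn₀⟩ := Filter.eventually_atTop.1 (htend.eventually_gt_atTop (2 * β r / ε))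
  refine ⟨n₀, fun n hn => ?_⟩
  have h1 := hn₀ n hn
  rw [div_lt_iff₀ hε] at h1
  have hβ0 : (0 : ℝ) < β n := by exact_mod_cast hβpos n
  have h2 : (r : ℝ) * ({g ∈ ball S (n : ℝ) | ¬ P g}).ncard ≤ r * β r + D * β n := by
    exact_mod_cast hbad n r
  rw [Real.dist_eq, sub_zero, abs_of_nonneg (by positivity), div_lt_iff₀ hβ0]
  have h3 : (r : ℝ) * (2 * β r) < r * (β n * ε) := by gcongr
  have h4 : (2 * D : ℝ) * β n < r * ε * β n := by gcongr
  have h5 : (r : ℝ) * ({g ∈ ball S (n : ℝ) | ¬ P g}).ncard < r * (ε * β n) := by linarith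
  exact lt_of_mul_lt_mul_left h5 hr0.le

end WordLength

lemma NonVirtuallyCyclic.infinite {G : Type*} [Group G] (h : NonVirtuallyCyclic G) :
    Infinite G := by
  by_contra hfin
  rw [not_infinite_iff_finite] at hfin
  exact h ⟨⊥, inferInstance, inferInstance⟩

namespace HypDist

variable {G : Type*} [Group G] {H : HypDist G} {ψ : G} {c η : ℝ}

/-- Generic elements have large translation length and the WPD property. -/
lemma IsAxis.tendsto_ncard_div (hψ : H.IsAxis ψ c η) (hG : NonVirtuallyCyclic G) {S : Finset G}
    (hS : Subgroup.closure (S : Set G) = ⊤) {M : ℝ} (hM : 0 < M) (P : G → Prop)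
    (hP : ∀ g, (∃ τ, M < τ ∧ Filter.Tendsto (fun n : ℕ => H.d 1 (g ^ n) / n) Filter.atTop (nhds τ)) →
      (∀ K : ℝ, ∃ N : ℕ, {k | H.d 1 k ≤ K ∧ H.d (g ^ N) (k * g ^ N) ≤ K}.Finite) → P g) :
    Filter.Tendsto (fun n : ℕ => ({g ∈ ball S (n : ℝ) | P g}.ncard : ℝ) /
      ((ball S (n : ℝ)).ncard : ℝ)) Filter.atTop (nhds 1) := by
  have hδ := H.δ_nonneg
  have := hG.infinite
  obtain ⟨c₀, hc₀, hprobes⟩ := hψ.exists_probes hG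
  set C := 1000 * (c₀ + H.δ) + M + 3 with hC
  obtain ⟨F, hF, hFsel⟩ := hprobes C
  have hbound : ∀ b ∈ F, ∃ N : ℕ, ∀ (g : G) (U : Finset G), (∀ u ∈ U, H.Admissible c₀ b g u ∧
      ¬ H.IsGood (14 * c₀ + 10 * H.δ) b (u * b⁻¹ * u⁻¹ * g)) → U.card ≤ N := fun b hb =>
    (hF b hb).exists_card_le hc₀ (by linarith [(hF b hb).le]) (by linarith)
  choose! N hN using hbound
  refine tendsto_ncard_ball_inter_div hS (F := F) (N := F.sup N)
    (T := fun b g u => H.Admissible c₀ b g u ∧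
      ¬ H.IsGood (14 * c₀ + 10 * H.δ) b (u * b⁻¹ * u⁻¹ * g)) P
    (fun b hb g U hU => (hN b hb g U hU).trans (Finset.le_sup hb)) fun g hg u v huv => ?_
  obtain ⟨b, hb, h1, h2, h3, h4⟩ := hFsel u⁻¹ (v * u)⁻¹ v (v * u)
  refine ⟨b, hb, ⟨?_, ?_, ?_, ?_⟩, fun hgood => hg ?_⟩
  · rw [← H.gp_mul u⁻¹]
    simpa using h1
  · rw [← H.gp_mul (u * b)⁻¹]
    simpa [mul_assoc] using h3
  · rw [← H.gp_mul u⁻¹]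
    simpa [mul_assoc] using h2
  · rw [← H.gp_mul (u * b)⁻¹]
    simpa [mul_assoc] using h4
  · have e : u * b⁻¹ * u⁻¹ * (u * b * v) = g := by
      rw [← huv]
      group
    rw [e] at hgood
    have hle := (hF b hb).le
    obtain ⟨τ, hτ, hlim⟩ := hgood.exists_tendsto (M := M + 1) (by linarith) (by linarith)
    refine hP g ⟨τ, by linarith, hlim⟩ fun K => hgood.wpd (M := M) (by linarith) hM
      ((hF b hb).fin.subset fun k hk => ⟨?_, ?_⟩) K
    · linarith [hk.1]
    · linarith [hk.2]

end HypDist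

section Geometry

variable {X : Type*} [MetricSpace X] {δ : ℝ}

lemma GeodesicSegment.isPreconnected_seg (γ : GeodesicSegment X) : IsPreconnected γ.seg := by
  refine isPreconnected_Icc.image _ (LipschitzOnWith.continuousOn (K := 1) ?_)
  refine LipschitzOnWith.of_dist_le_mul fun s hs t ht => ?_
  rw [γ.isom s hs t ht, NNReal.coe_one, one_mul, Real.dist_eq]

lemma GeodesicSegment.initial_mem_seg (γ : GeodesicSegment X) : γ.initial ∈ γ.seg :=
  ⟨0, ⟨le_rfl, γ.len_nonneg⟩, rfl⟩

lemma GeodesicSegment.terminal_mem_seg (γ : GeodesicSegment X) : γ.terminal ∈ γ.seg :=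
  ⟨γ.len, ⟨γ.len_nonneg, le_rfl⟩, rfl⟩

lemma GeodesicSegment.dist_add_dist (γ : GeodesicSegment X) {p : X} (hp : p ∈ γ.seg) :
    dist γ.initial p + dist p γ.terminal = dist γ.initial γ.terminal := by
  obtain ⟨t, ht, rfl⟩ := hp
  unfold initial terminal
  have h0 : (0 : ℝ) ∈ Set.Icc 0 γ.len := ⟨le_rfl, γ.len_nonneg⟩
  have h1 : γ.len ∈ Set.Icc 0 γ.len := ⟨γ.len_nonneg, le_rfl⟩
  rw [γ.isom 0 h0 t ht, γ.isom t ht _ h1, γ.isom 0 h0 _ h1, abs_of_nonpos (by linarith [ht.1]),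
    abs_of_nonpos (by linarith [ht.2]), abs_of_nonpos (by linarith [γ.len_nonneg])]
  ring

lemma GeodesicSegment.dist_add_dist_le (γ : GeodesicSegment X) (hδ : 0 < δ) {p : X}
    (hp : p ∈ Metric.cthickening δ γ.seg) :
    dist γ.initial p + dist p γ.terminal ≤ dist γ.initial γ.terminal + 4 * δ := by
  obtain ⟨q, hq, hpq⟩ := Metric.mem_thickening_iff.1
    (Metric.cthickening_subset_thickening' (by linarith) (by linarith : δ < 2 * δ) _ hp)
  have h1 := γ.dist_add_dist hq
  have h2 := dist_triangle γ.initial q p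
  have h3 := dist_triangle p q γ.terminal
  rw [dist_comm q p] at h2
  linarith

lemma IsDeltaHyperbolic.four_point (h : IsDeltaHyperbolic X δ) (hδ : 0 < δ)
    (hgeo : IsGeodesicSpace X) (x y z w : X) :
    dist x y + dist z w ≤ dist x z + dist y w + 8 * δ ∨
      dist x y + dist z w ≤ dist x w + dist y z + 8 * δ := by
  obtain ⟨γ, hγ, hγ'⟩ := hgeo x y
  obtain ⟨α₁, hα₁, hα₁'⟩ := hgeo x z
  obtain ⟨α₂, hα₂, hα₂'⟩ := hgeo z y
  obtain ⟨β₁, hβ₁, hβ₁'⟩ := hgeo x w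
  obtain ⟨β₂, hβ₂, hβ₂'⟩ := hgeo w y
  have s1 := h α₁ α₂ γ (by rw [hα₁, hγ]) (by rw [hα₁', hα₂]) (by rw [hα₂', hγ'])
  have s2 := h β₁ β₂ γ (by rw [hβ₁, hγ]) (by rw [hβ₁', hβ₂]) (by rw [hβ₂', hγ'])
  rw [Metric.cthickening_union] at s1 s2
  obtain ⟨p, hp, hp1, hp2⟩ := isPreconnected_closed_iff.1 γ.isPreconnected_seg _ _
    Metric.isClosed_cthickening Metric.isClosed_cthickening s1
    ⟨x, hγ ▸ γ.initial_mem_seg, Metric.self_subset_cthickening _ (hα₁ ▸ α₁.initial_mem_seg)⟩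
    ⟨y, hγ' ▸ γ.terminal_mem_seg, Metric.self_subset_cthickening _ (hα₂' ▸ α₂.terminal_mem_seg)⟩
  have e0 := γ.dist_add_dist hp
  have e1 := α₁.dist_add_dist_le hδ hp1
  have e2 := α₂.dist_add_dist_le hδ hp2
  rw [hγ, hγ'] at e0
  rw [hα₁, hα₁'] at e1
  rw [hα₂, hα₂'] at e2
  have e3 := dist_triangle z p w
  have c1 := dist_comm p z
  have c2 := dist_comm y z
  have c3 := dist_comm y w
  have c4 := dist_comm p w
  rcases s2 hp with hp3 | hp3
  · have e4 := β₁.dist_add_dist_le hδ hp3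
    rw [hβ₁, hβ₁'] at e4
    right
    linarith
  · have e4 := β₂.dist_add_dist_le hδ hp3
    rw [hβ₂, hβ₂'] at e4
    left
    linarith

/-- The orbit pseudo-metric of an isometric action on a hyperbolic space. -/
def orbitDist {G : Type*} [Group G] (hδ : 0 < δ) (hgeo : IsGeodesicSpace X)
    (hhyp : IsDeltaHyperbolic X δ) (ρ : G → X → X) (hisom : ∀ g : G, Isometry (ρ g))
    (hmul : ∀ g h : G, ∀ x : X, ρ (g * h) x = ρ g (ρ h x)) (x0 : X) : HypDist G where
  d g h := dist (ρ g x0) (ρ h x0)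
  δ := 8 * δ
  δ_nonneg := by positivity
  d_self _ := dist_self _
  d_comm _ _ := dist_comm _ _
  d_tri _ _ _ := dist_triangle _ _ _
  d_mul g x y := by rw [hmul, hmul, (hisom g).dist_eq]
  four _ _ _ _ := hhyp.four_point hδ hgeo _ _ _ _

end Geometry

/-- Theorem 1.2: WPD loxodromics with large translation length are generic. -/
theorem wpd_loxodromic_generic {G : Type*} [Group G] {X : Type*} [MetricSpace X]
    (S : Finset G) (hSgen : Subgroup.closure (S : Set G) = ⊤)
    (hNVC : NonVirtuallyCyclic G)
    (δ : ℝ) (hδ : 0 < δ) (hgeo : IsGeodesicSpace X) (hhyp : IsDeltaHyperbolic X δ)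
    (ρ : G → X → X) (hisom : ∀ g : G, Isometry (ρ g))
    (hmul : ∀ g h : G, ∀ x : X, ρ (g * h) x = ρ g (ρ h x)) (hone : ∀ x : X, ρ 1 x = x)
    (x0 : X) (φ : G)
    (hlox : IsLoxodromic ρ x0 φ) (hwpd : HasWPD ρ x0 φ)
    (M : ℝ) (hM : 0 < M) :
    Filter.Tendsto (fun n : ℕ =>
      (({g ∈ ball S (n:ℝ) | IsLoxodromic ρ x0 g ∧ HasWPD ρ x0 g ∧
          ∃ τ : ℝ, M < τ ∧
            Filter.Tendsto (fun k : ℕ => dist x0 (ρ (g ^ k) x0) / k)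
              Filter.atTop (nhds τ)}).ncard : ℝ) /
        ((ball S (n:ℝ)).ncard : ℝ))
      Filter.atTop (nhds 1) := by
  set H := orbitDist hδ hgeo hhyp ρ hisom hmul x0 with hH
  have hd : ∀ g h : G, H.d g h = dist (ρ g x0) (ρ h x0) := fun _ _ => rfl
  obtain ⟨τ, hτ, hlim⟩ := hlox
  obtain ⟨ψ, c, η, hψ⟩ := HypDist.exists_isAxis (H := H) (φ := φ) hτ
    (by simpa only [hd, hone] using hlim) fun K hK => by
      obtain ⟨N, -, hfin, -⟩ := hwpd K hK
      exact ⟨N, by simpa only [hd, hone, hmul] using hfin⟩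
  refine hψ.tendsto_ncard_div hNVC hSgen hM _ fun g hg hg' => ?_
  simp only [hd, hone, hmul] at hg hg'
  obtain ⟨σ, hσ, hgσ⟩ := hg
  refine ⟨⟨σ, hM.trans hσ, hgσ⟩, fun K _ => ?_, σ, hσ, hgσ⟩
  obtain ⟨N, hfin⟩ := hg' K
  have hfin' := hfin.subset fun k (hk : dist x0 (ρ k x0) < K ∧
    dist (ρ (g ^ N) x0) (ρ k (ρ (g ^ N) x0)) < K) => ⟨hk.1.le, hk.2.le⟩
  exact ⟨N, _, hfin', Nat.lt_succ_self _⟩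

end AcylCount
end

section
/- Let X be a geodesic δ-hyperbolic space, let γ be a finite geodesic in X, let x, y ∈ X, and let η be a subsegment of γ that contains π_γ(x) ∪ π_γ(y). Then for any geodesic [x,y] from x to y, the projection π_γ([x,y]) is contained in the closed 60δ-neighborhood of η. -/
namespace AcylCount

variable {X : Type*} [MetricSpace X]

/-! ### Word metric -/

variable {G : Type*} [Group G]

/-! ### Geodesic segments: compactness, betweenness, reversal and subsegments -/

namespace GeodesicSegment

theorem initial_mem (γ : GeodesicSegment X) : γ.initial ∈ γ.seg :=
  ⟨0, ⟨le_rfl, γ.len_nonneg⟩, rfl⟩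

theorem continuousOn (γ : GeodesicSegment X) : ContinuousOn γ.toFun (Set.Icc 0 γ.len) := by
  have h : LipschitzOnWith 1 γ.toFun (Set.Icc 0 γ.len) :=
    LipschitzOnWith.of_dist_le_mul fun s hs t ht => by
      rw [γ.isom s hs t ht, Real.dist_eq, NNReal.coe_one, one_mul]
  exact h.continuousOn

theorem isCompact_seg (γ : GeodesicSegment X) : IsCompact γ.seg :=
  isCompact_Icc.image_of_continuousOn γ.continuousOn

theorem dist_add_dist_eq (γ : GeodesicSegment X) {u : X} (hu : u ∈ γ.seg) :
    dist γ.initial u + dist u γ.terminal = dist γ.initial γ.terminal := by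
  obtain ⟨s, hs, rfl⟩ := hu
  have h0 : (0 : ℝ) ∈ Set.Icc 0 γ.len := ⟨le_rfl, γ.len_nonneg⟩
  have h1 : γ.len ∈ Set.Icc 0 γ.len := ⟨γ.len_nonneg, le_rfl⟩
  simp only [initial, terminal]
  rw [γ.isom _ h0 _ hs, γ.isom _ hs _ h1, γ.isom _ h0 _ h1, abs_of_nonpos (by linarith [hs.1]),
    abs_of_nonpos (by linarith [hs.2]), abs_of_nonpos (by linarith [γ.len_nonneg])]
  ring

theorem exists_mem_dist_eq (γ : GeodesicSegment X) {t : ℝ} (ht0 : 0 ≤ t)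
    (ht : t ≤ dist γ.initial γ.terminal) : ∃ m ∈ γ.seg, dist γ.initial m = t := by
  have h0 : (0 : ℝ) ∈ Set.Icc 0 γ.len := ⟨le_rfl, γ.len_nonneg⟩
  have h1 : γ.len ∈ Set.Icc 0 γ.len := ⟨γ.len_nonneg, le_rfl⟩
  simp only [initial, terminal] at ht ⊢
  rw [γ.isom _ h0 _ h1, zero_sub, abs_neg, abs_of_nonneg γ.len_nonneg] at ht
  refine ⟨γ.toFun t, ⟨t, ⟨ht0, ht⟩, rfl⟩, ?_⟩
  rw [γ.isom _ h0 _ ⟨ht0, ht⟩, zero_sub, abs_neg, abs_of_nonneg ht0]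

theorem exists_reverse (γ : GeodesicSegment X) : ∃ σ : GeodesicSegment X,
    σ.initial = γ.terminal ∧ σ.terminal = γ.initial ∧ σ.seg ⊆ γ.seg := by
  refine ⟨⟨γ.len, γ.len_nonneg, fun t => γ.toFun (γ.len - t), fun s hs t ht => ?_⟩, ?_, ?_, ?_⟩
  · rw [γ.isom _ ⟨by linarith [hs.2], by linarith [hs.1]⟩ _
      ⟨by linarith [ht.2], by linarith [ht.1]⟩, abs_sub_comm]
    congr 1
    ring
  · simp [initial, terminal]
  · simp [initial, terminal]
  · rintro _ ⟨t, ht, rfl⟩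
    exact ⟨γ.len - t, ⟨by linarith [ht.2], by linarith [ht.1]⟩, rfl⟩

theorem exists_restrict (γ : GeodesicSegment X) {a b : ℝ} (ha : 0 ≤ a) (hab : a ≤ b)
    (hb : b ≤ γ.len) : ∃ σ : GeodesicSegment X,
    σ.initial = γ.toFun a ∧ σ.terminal = γ.toFun b ∧ σ.seg ⊆ γ.seg := by
  refine ⟨⟨b - a, sub_nonneg.2 hab, fun t => γ.toFun (a + t), fun s hs t ht => ?_⟩, ?_, ?_, ?_⟩
  · rw [γ.isom _ ⟨by linarith [hs.1], by linarith [hs.2]⟩ _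
      ⟨by linarith [ht.1], by linarith [ht.2]⟩]
    congr 1
    ring
  · simp [initial]
  · simp [terminal]
  · rintro _ ⟨t, ht, rfl⟩
    exact ⟨a + t, ⟨by linarith [ht.1], by linarith [ht.2]⟩, rfl⟩

theorem exists_between (γ : GeodesicSegment X) {p q : X} (hp : p ∈ γ.seg) (hq : q ∈ γ.seg) :
    ∃ σ : GeodesicSegment X, σ.initial = p ∧ σ.terminal = q ∧ σ.seg ⊆ γ.seg := by
  obtain ⟨s, hs, rfl⟩ := hp
  obtain ⟨t, ht, rfl⟩ := hq
  rcases le_total s t with hst | hts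
  · exact γ.exists_restrict hs.1 hst ht.2
  · obtain ⟨σ, hi, ht', hσ⟩ := γ.exists_restrict ht.1 hts hs.2
    obtain ⟨τ, hi', ht'', hτ⟩ := σ.exists_reverse
    exact ⟨τ, hi'.trans ht', ht''.trans hi, hτ.trans hσ⟩

theorem IsSubsegment.seg_subset {η γ : GeodesicSegment X} (h : η.IsSubsegment γ) :
    η.seg ⊆ γ.seg := by
  obtain ⟨a, b, ha, -, hb, hlen, heq⟩ := h
  rintro _ ⟨t, ht, rfl⟩
  rw [heq t ht]
  exact ⟨a + t, ⟨by linarith [ht.1], by linarith [ht.2]⟩, rfl⟩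

end GeodesicSegment

/-! ### Closest point projections -/

theorem proj_nonempty (γ : GeodesicSegment X) (x : X) : (proj γ x).Nonempty := by
  obtain ⟨p, hp, h⟩ := γ.isCompact_seg.exists_infDist_eq_dist ⟨_, γ.initial_mem⟩ x
  exact ⟨p, hp, h.symm⟩

theorem dist_le_of_mem_proj {γ : GeodesicSegment X} {x p q : X} (hp : p ∈ proj γ x)
    (hq : q ∈ γ.seg) : dist x p ≤ dist x q :=
  hp.2 ▸ Metric.infDist_le_dist_of_mem hq

theorem IsDeltaHyperbolic.exists_dist_le {δ : ℝ} (hhyp : IsDeltaHyperbolic X δ) (hδ : 0 ≤ δ)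
    {γ₁ γ₂ γ₃ : GeodesicSegment X} (h₁ : γ₁.initial = γ₃.initial)
    (h₂ : γ₁.terminal = γ₂.initial) (h₃ : γ₂.terminal = γ₃.terminal) {z : X} (hz : z ∈ γ₃.seg) :
    ∃ w ∈ γ₁.seg ∪ γ₂.seg, dist z w ≤ δ := by
  have h := hhyp γ₁ γ₂ γ₃ h₁ h₂ h₃ hz
  rw [(γ₁.isCompact_seg.union γ₂.isCompact_seg).cthickening_eq_biUnion_closedBall hδ] at h
  simpa using h

/-- A point of `γ` that almost realizes the distance from `z` to `γ` is close to the projection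
of `z`. -/
theorem dist_proj_le_of_dist_le {δ c : ℝ} (hδ : 0 ≤ δ) (hgeo : IsGeodesicSpace X)
    (hhyp : IsDeltaHyperbolic X δ) {γ : GeodesicSegment X} {z p q : X} (hp : p ∈ proj γ z)
    (hq : q ∈ γ.seg) (hc : dist z q ≤ dist z p + c) : dist p q ≤ 4 * δ + c := by
  by_contra! hlt
  have hc0 : 0 ≤ c := by linarith [dist_le_of_mem_proj hp hq]
  obtain ⟨σ, hσi, hσt, hσ⟩ := γ.exists_between hp.1 hq
  obtain ⟨β, hβi, hβt⟩ := hgeo p z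
  obtain ⟨κ, hκi, hκt⟩ := hgeo z q
  obtain ⟨m, hm, hpm⟩ := σ.exists_mem_dist_eq (t := 2 * δ + (dist p q - (4 * δ + c)) / 2)
    (by linarith) (by rw [hσi, hσt]; linarith)
  have hmq := σ.dist_add_dist_eq hm
  have hzm := dist_le_of_mem_proj hp (hσ hm)
  rw [hσi] at hpm
  rw [hσi, hσt] at hmq
  obtain ⟨w, hw | hw, hmw⟩ := hhyp.exists_dist_le hδ (hβi.trans hσi.symm) (hβt.trans hκi.symm)
    (hκt.trans hσt.symm) hm
  · have hpw := β.dist_add_dist_eq hw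
    rw [hβi, hβt] at hpw
    linarith [dist_triangle z w m, dist_comm w z, dist_comm m w, dist_comm p z,
      dist_triangle p w m]
  · have hwq := κ.dist_add_dist_eq hw
    rw [hκi, hκt] at hwq
    linarith [dist_triangle z w m, dist_comm m w, dist_triangle m w q]

/-- A point close to a geodesic from `x` to a closest point of `γ` projects close to that
closest point. -/
theorem dist_proj_le_of_between {δ r : ℝ} (hδ : 0 ≤ δ) (hgeo : IsGeodesicSpace X)
    (hhyp : IsDeltaHyperbolic X δ) {γ : GeodesicSegment X} {x x' w z p : X}
    (hx' : x' ∈ proj γ x) (hw : dist x w + dist w x' = dist x x') (hzw : dist z w ≤ r)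
    (hp : p ∈ proj γ z) : dist p x' ≤ 4 * δ + 2 * r := by
  refine dist_proj_le_of_dist_le hδ hgeo hhyp hp hx'.1 ?_
  linarith [dist_le_of_mem_proj hx' hp.1, dist_triangle4 x w z p, dist_comm w z,
    dist_triangle z w x']

/-- Corollary 2.3: projections onto a geodesic are monotone, up to error `60δ`. -/
theorem proj_in_nbhd_of_subsegment {X : Type*} [MetricSpace X]
    (δ : ℝ) (hδ : 0 < δ) (hgeo : IsGeodesicSpace X) (hhyp : IsDeltaHyperbolic X δ)
    (γ η : GeodesicSegment X) (x y : X)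
    (hsub : η.IsSubsegment γ)
    (hproj : proj γ x ∪ proj γ y ⊆ η.seg)
    (α : GeodesicSegment X) (hαi : α.initial = x) (hαt : α.terminal = y) :
    projSet γ α.seg ⊆ Metric.cthickening (60 * δ) η.seg := by
  have hδ0 := hδ.le
  intro p hp
  simp only [projSet, Set.mem_iUnion, exists_prop] at hp
  obtain ⟨z, hz, hp⟩ := hp
  obtain ⟨x', hx'⟩ := proj_nonempty γ x
  obtain ⟨y', hy'⟩ := proj_nonempty γ y
  have hx'η : x' ∈ η.seg := hproj (Or.inl hx')
  have hy'η : y' ∈ η.seg := hproj (Or.inr hy')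
  suffices h : ∃ q ∈ η.seg, dist p q ≤ 8 * δ by
    obtain ⟨q, hq, hpq⟩ := h
    exact Metric.mem_cthickening_of_dist_le p q _ _ hq (by linarith)
  obtain ⟨β, hβi, hβt⟩ := hgeo x x'
  obtain ⟨ρ, hρi, hρt⟩ := hgeo x' y
  obtain ⟨κ, hκi, hκt⟩ := hgeo y' y
  obtain ⟨σ, hσi, hσt, hσ⟩ := η.exists_between hx'η hy'η
  obtain ⟨w, hw | hw, hzw⟩ := hhyp.exists_dist_le hδ0 (hβi.trans hαi.symm)
    (hβt.trans hρi.symm) (hρt.trans hαt.symm) hz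
  · have hb := β.dist_add_dist_eq hw
    rw [hβi, hβt] at hb
    exact ⟨x', hx'η, by linarith [dist_proj_le_of_between hδ0 hgeo hhyp hx' hb hzw hp]⟩
  · obtain ⟨v, hv | hv, hwv⟩ := hhyp.exists_dist_le hδ0 (hσi.trans hρi.symm)
      (hσt.trans hκi.symm) (hκt.trans hρt.symm) hw
    · refine ⟨v, hσ hv, ?_⟩
      linarith [dist_le_of_mem_proj hp (hsub.seg_subset (hσ hv)), dist_triangle z w v,
        dist_triangle p z v, dist_comm p z]
    · have hb := κ.dist_add_dist_eq hv
      rw [hκi, hκt] at hb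
      have hb' : dist y v + dist v y' = dist y y' := by
        linarith [dist_comm y v, dist_comm v y', dist_comm y y']
      have hzv : dist z v ≤ 2 * δ := by linarith [dist_triangle z w v]
      exact ⟨y', hy'η, by linarith [dist_proj_le_of_between hδ0 hgeo hhyp hy' hb' hzv hp]⟩

end AcylCount
end
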